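/- Let d ≥ 1 and let 𝒬 be a finite set of dyadic cubes in ℝ^d such that every dyadic cube P ⊆ ⋃_{Q∈𝒬} Q that contains some member of 𝒬 itself belongs to 𝒬. Let Ω ⊆ ℝ^d be open with ⋃_{Q∈𝒬} interior(Q) ⊆ Ω and let f ∈ L¹(Ω). For each λ ∈ ℝ let 𝒬_λ be the set of maximal cubes (with respect to inclusion) of { Q ∈ 𝒬 : f_Q > λ }. Then there is a constant C depending only on d such that Σ_{Q∈𝒬} ∫_ℝ 1{ Q ∈ 𝒬_λ and |Q ∩ {f > λ}| < 2^{-d-2}|Q| } · σ(∂Q) dλ ≤ C · var_{⋃_{Q∈𝒬} interior(Q)} f, where ∂Q denotes the topological boundary of Q. -/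

import Mathlib

open MeasureTheory Metric Set Filter
open scoped ENNReal Topology

noncomputable section

/-- `ℝ^d` as Euclidean space. -/
abbrev Ed (d : ℕ) := EuclideanSpace ℝ (Fin d)

/-- A dyadic cube `∏_i [2^n m_i, 2^n (m_i + 1))`. -/
def IsDyadicCube {d : ℕ} (Q : Set (Ed d)) : Prop :=
  ∃ (n : ℤ) (m : Fin d → ℤ),
    Q = {x : Ed d | ∀ i, x i ∈ Set.Ico ((2:ℝ)^n * m i) ((2:ℝ)^n * (m i + 1))}

/-- Divergence of a vector field `φ : ℝ^d → ℝ^d`. -/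
def divergence {d : ℕ} (φ : Ed d → Ed d) (x : Ed d) : ℝ :=
  ∑ i, fderiv ℝ φ x (EuclideanSpace.single i 1) i

/-- The variation of `f` in `Ω`. -/
def var {d : ℕ} (Ω : Set (Ed d)) (f : Ed d → ℝ) : ℝ≥0∞ :=
  ⨆ φ ∈ {φ : Ed d → Ed d | ContDiff ℝ 1 φ ∧ HasCompactSupport φ ∧ tsupport φ ⊆ Ω ∧
      ∀ x, ‖φ x‖ ≤ 1},
    ENNReal.ofReal (∫ x in Ω, f x * divergence φ x)

/-- `Q` is a maximal cube (w.r.t. inclusion) of `{Q ∈ 𝒬 : ⨍_Q f > λ}`. -/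
def IsMaximalCube {d : ℕ} (𝒬 : Finset (Set (Ed d))) (f : Ed d → ℝ) (lam : ℝ)
    (Q : Set (Ed d)) : Prop :=
  Q ∈ 𝒬 ∧ lam < ⨍ z in Q, f z ∧
    ∀ P ∈ 𝒬, lam < (⨍ z in P, f z) → Q ⊆ P → P = Q

/-- The dyadic block of side `2 ^ k` of the integer lattice that contains `x`. -/
def blk {d : ℕ} (k : ℕ) (x : Fin d → ℤ) : Finset (Fin d → ℤ) :=
  Fintype.piFinset fun i => Finset.Ico (2 ^ k * (x i / 2 ^ k)) (2 ^ k * (x i / 2 ^ k) + 2 ^ k)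

lemma mem_blk {d : ℕ} {k : ℕ} {x y : Fin d → ℤ} :
    y ∈ blk k x ↔ ∀ i, y i / 2 ^ k = x i / 2 ^ k := by
  have hp : (0:ℤ) < 2 ^ k := by positivity
  simp only [blk, Fintype.mem_piFinset, Finset.mem_Ico]
  refine forall_congr' fun i => ?_
  rw [Int.ediv_eq_iff_of_pos hp]
  constructor <;> rintro ⟨h1, h2⟩ <;> constructor <;> linarith

lemma mem_blk_self {d : ℕ} (k : ℕ) (x : Fin d → ℤ) : x ∈ blk k x := mem_blk.2 fun _ => rfl

lemma mem_blk_comm {d : ℕ} {k : ℕ} {x y : Fin d → ℤ} : y ∈ blk k x ↔ x ∈ blk k y := by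
  simp only [mem_blk, eq_comm]

lemma blk_eq {d : ℕ} {k : ℕ} {x y : Fin d → ℤ} (h : y ∈ blk k x) : blk k y = blk k x := by
  ext z
  simp only [mem_blk] at *
  simp only [h]

lemma blk_mono {d : ℕ} {j k : ℕ} (hjk : j ≤ k) (x : Fin d → ℤ) : blk j x ⊆ blk k x := by
  intro y
  simp only [mem_blk]
  intro h i
  obtain ⟨l, rfl⟩ := Nat.exists_eq_add_of_le hjk
  rw [pow_add, ← Int.ediv_ediv_of_nonneg (by positivity), h i,
    Int.ediv_ediv_of_nonneg (by positivity)]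

lemma toNat_two_pow (k : ℕ) : ((2:ℤ) ^ k).toNat = 2 ^ k := by
  have := Int.toNat_natCast (2 ^ k)
  push_cast at this
  exact this

lemma card_blk {d : ℕ} (k : ℕ) (x : Fin d → ℤ) : (blk k x).card = (2 ^ d) ^ k := by
  simp [blk, Fintype.card_piFinset, toNat_two_pow, ← pow_mul, mul_comm]

lemma blk_zero {d : ℕ} (x : Fin d → ℤ) : blk 0 x = {x} := by
  ext y
  simp [mem_blk, funext_iff]

/-- The average of `u` over the block of side `2 ^ k` around `x`. -/
def bavg {d : ℕ} (u : (Fin d → ℤ) → ℝ) (k : ℕ) (x : Fin d → ℤ) : ℝ :=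
  (∑ y ∈ blk k x, u y) / (2 ^ d) ^ k

lemma bavg_congr {d : ℕ} (u : (Fin d → ℤ) → ℝ) {k : ℕ} {x y : Fin d → ℤ} (h : y ∈ blk k x) :
    bavg u k y = bavg u k x := by
  rw [bavg, bavg, blk_eq h]

lemma bavg_zero {d : ℕ} (u : (Fin d → ℤ) → ℝ) (x : Fin d → ℤ) : bavg u 0 x = u x := by
  simp [bavg, blk_zero]

lemma sum_blk_eq {d : ℕ} (u : (Fin d → ℤ) → ℝ) (k : ℕ) (x : Fin d → ℤ) :
    ∑ y ∈ blk k x, u y = (2 ^ d) ^ k * bavg u k x := by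
  rw [bavg]; field_simp

lemma bavg_mono {d : ℕ} {u v : (Fin d → ℤ) → ℝ} {k : ℕ} {x : Fin d → ℤ}
    (h : ∀ y ∈ blk k x, u y ≤ v y) : bavg u k x ≤ bavg v k x := by
  unfold bavg
  gcongr with y hy
  exact h y hy

lemma bavg_nonneg {d : ℕ} {u : (Fin d → ℤ) → ℝ} (h : ∀ y, 0 ≤ u y) (k : ℕ) (x : Fin d → ℤ) :
    0 ≤ bavg u k x :=
  div_nonneg (Finset.sum_nonneg fun y _ => h y) (by positivity)

lemma bavg_const {d : ℕ} (c : ℝ) (k : ℕ) (x : Fin d → ℤ) : bavg (fun _ => c) k x = c := by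
  simp [bavg, card_blk]

lemma bavg_le_succ {d : ℕ} {u : (Fin d → ℤ) → ℝ} (h : ∀ y, 0 ≤ u y) (k : ℕ) (x : Fin d → ℤ) :
    bavg u k x ≤ 2 ^ d * bavg u (k + 1) x := by
  have : ∑ y ∈ blk k x, u y ≤ ∑ y ∈ blk (k + 1) x, u y :=
    Finset.sum_le_sum_of_subset_of_nonneg (blk_mono (Nat.le_succ k) x) fun y _ _ => h y
  rw [sum_blk_eq, sum_blk_eq, pow_succ, mul_assoc] at this
  exact le_of_mul_le_mul_left this (by positivity)

/-- Averaging preserves the sum over a set that is a union of blocks. -/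
lemma sum_bavg {d : ℕ} (u : (Fin d → ℤ) → ℝ) (k : ℕ) (S : Finset (Fin d → ℤ))
    (hS : ∀ y ∈ S, blk k y ⊆ S) : ∑ x ∈ S, bavg u k x = ∑ x ∈ S, u x := by
  simp only [bavg, ← Finset.sum_div]
  rw [Finset.sum_comm' (t' := S) (s' := fun y => blk k y)]
  · simp only [Finset.sum_const, card_blk, nsmul_eq_mul]
    rw [← Finset.mul_sum]
    push_cast
    field_simp
  · intro x y
    constructor
    · rintro ⟨hx, hy⟩
      exact ⟨mem_blk_comm.1 hy, hS x hx hy⟩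
    · rintro ⟨hx, hy⟩
      exact ⟨hS y hy hx, mem_blk_comm.1 hx⟩

lemma blk_subset_blk {d : ℕ} {j k : ℕ} (hjk : j ≤ k) {x y : Fin d → ℤ} (hy : y ∈ blk k x) :
    blk j y ⊆ blk k x := by
  rw [← blk_eq hy]; exact blk_mono hjk y

lemma bavg_bavg {d : ℕ} (u : (Fin d → ℤ) → ℝ) {j k : ℕ} (hjk : j ≤ k) (x : Fin d → ℤ) :
    bavg (bavg u j) k x = bavg u k x := by
  rw [bavg, sum_bavg _ _ _ fun y hy => blk_subset_blk hjk hy, ← bavg]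

lemma bavg_add {d : ℕ} (u v : (Fin d → ℤ) → ℝ) (k : ℕ) (x : Fin d → ℤ) :
    bavg (fun y => u y + v y) k x = bavg u k x + bavg v k x := by
  simp [bavg, Finset.sum_add_distrib, add_div]

lemma bavg_sum {d : ℕ} {ι : Type*} (s : Finset ι) (u : ι → (Fin d → ℤ) → ℝ) (k : ℕ)
    (x : Fin d → ℤ) :
    bavg (fun y => ∑ i ∈ s, u i y) k x = ∑ i ∈ s, bavg (u i) k x := by
  simp only [bavg, ← Finset.sum_div]
  rw [Finset.sum_comm]

lemma bavg_mul_const {d : ℕ} (u v : (Fin d → ℤ) → ℝ) {k : ℕ} {x : Fin d → ℤ}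
    (hv : ∀ y ∈ blk k x, v y = v x) :
    bavg (fun y => u y * v y) k x = bavg u k x * v x := by
  rw [bavg, bavg, Finset.sum_congr rfl fun y hy => by rw [hv y hy], ← Finset.sum_mul]
  ring

/-- A threshold above which `g` has small density in `S`, and at which the density is not small
unless the threshold is the prescribed lower bound. -/
lemma exists_threshold {α : Type*} (S : Finset α) (g : α → ℝ) (m : ℝ) {c : ℝ} (hc : 0 ≤ c) :
    ∃ l, m ≤ l ∧ ((S.filter fun y => l < g y).card : ℝ) ≤ c * S.card ∧
      (l = m ∨ c * S.card ≤ ((S.filter fun y => l ≤ g y).card : ℝ)) := by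
  classical
  let T : Finset ℝ := insert m ((S.image g).filter fun t => m ≤ t)
  let T' := T.filter fun l => ((S.filter fun y => l < g y).card : ℝ) ≤ c * S.card
  have hT : T.Nonempty := ⟨m, by simp [T]⟩
  have hm : ∀ t ∈ T, m ≤ t := by
    intro t ht
    rcases Finset.mem_insert.1 ht with rfl | ht
    · exact le_rfl
    · exact (Finset.mem_filter.1 ht).2
  have hgT : ∀ y ∈ S, m ≤ g y → g y ∈ T := fun y hy h =>
    Finset.mem_insert_of_mem (Finset.mem_filter.2 ⟨Finset.mem_image_of_mem g hy, h⟩)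
  have hT' : T'.Nonempty := by
    refine ⟨T.max' hT, Finset.mem_filter.2 ⟨T.max'_mem hT, ?_⟩⟩
    rw [Finset.filter_false_of_mem]
    · simpa using by positivity
    · intro y hy h
      have := T.le_max' _ (hgT y hy ((hm _ (T.max'_mem hT)).trans h.le))
      linarith
  refine ⟨T'.min' hT', hm _ (Finset.mem_filter.1 (T'.min'_mem hT')).1,
    (Finset.mem_filter.1 (T'.min'_mem hT')).2, ?_⟩
  set l := T'.min' hT' with hl
  by_contra! hcon
  obtain ⟨h1, h2⟩ := hcon
  have hml : m < l := lt_of_le_of_ne (hm _ (Finset.mem_filter.1 (T'.min'_mem hT')).1) (Ne.symm h1)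
  let P := T.filter fun t => t < l
  have hP : P.Nonempty := ⟨m, by simp [P, T, hml]⟩
  have hp := P.max'_mem hP
  obtain ⟨hpT, hpl⟩ := Finset.mem_filter.1 hp
  have : P.max' hP ∈ T' := by
    refine Finset.mem_filter.2 ⟨hpT, le_trans ?_ h2.le⟩
    gcongr with y hy
    intro h
    by_contra! hlt
    have := P.le_max' (g y) (Finset.mem_filter.2 ⟨hgT y hy ((hm _ hpT).trans h.le), hlt⟩)
    linarith
  have := T'.min'_le _ this
  linarith

/-- The lattice variation density of `u` at `y`, counting edges inside the block of side `2 ^ k`. -/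
def edgeVar {d : ℕ} (k : ℕ) (u : (Fin d → ℤ) → ℝ) (y : Fin d → ℤ) : ℝ :=
  ∑ i, if y + Pi.single i 1 ∈ blk k y then |u y - u (y + Pi.single i 1)| else 0

lemma edgeVar_nonneg {d : ℕ} (k : ℕ) (u : (Fin d → ℤ) → ℝ) (y : Fin d → ℤ) :
    0 ≤ edgeVar k u y :=
  Finset.sum_nonneg fun i _ => by split_ifs <;> positivity

lemma abs_sub_le_sum_Ico (v : ℤ → ℝ) {a b s t : ℤ} (hs : a ≤ s) (hst : s ≤ t) (ht : t < b) :
    |v s - v t| ≤ ∑ r ∈ Finset.Ico a (b - 1), |v r - v (r + 1)| := by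
  have h1 : |v s - v t| ≤ ∑ r ∈ Finset.Ico s t, |v r - v (r + 1)| := by
    clear ht
    induction t, hst using Int.leInduction with
    | base => simp
    | succ n hn ih =>
      have : Finset.Ico s (n + 1) = insert n (Finset.Ico s n) := by
        ext z; simp only [Finset.mem_Ico, Finset.mem_insert]; omega
      rw [this, Finset.sum_insert (by simp)]
      have := abs_sub_le (v s) (v n) (v (n + 1))
      linarith
  refine h1.trans (Finset.sum_le_sum_of_subset_of_nonneg ?_ fun _ _ _ => abs_nonneg _)
  intro z; simp only [Finset.mem_Ico]; omega

/-- Exchange the coordinates of `y` and `z` below `j`. -/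
def mix {d : ℕ} (j : ℕ) (y z : Fin d → ℤ) : Fin d → ℤ := fun i => if (i : ℕ) < j then z i else y i

lemma mix_mem_blk {d : ℕ} {k : ℕ} {x y z : Fin d → ℤ} (j : ℕ) (hy : y ∈ blk k x)
    (hz : z ∈ blk k x) : mix j y z ∈ blk k x := by
  simp only [mem_blk, mix] at *
  intro i
  split_ifs
  exacts [hz i, hy i]

lemma sum_mix {d : ℕ} (L : (Fin d → ℤ) → ℝ) (k j : ℕ) (x : Fin d → ℤ) :
    ∑ y ∈ blk k x, ∑ z ∈ blk k x, L (mix j y z) = (2 ^ d) ^ k * ∑ y ∈ blk k x, L y := by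
  have : ∑ y ∈ blk k x, ∑ z ∈ blk k x, L (mix j y z) = ∑ y ∈ blk k x, ∑ z ∈ blk k x, L y := by
    rw [← Finset.sum_product', ← Finset.sum_product']
    refine Finset.sum_nbij' (fun p => (mix j p.1 p.2, mix j p.2 p.1))
      (fun p => (mix j p.1 p.2, mix j p.2 p.1)) ?_ ?_ ?_ ?_ ?_
    · rintro ⟨a, b⟩ h
      rw [Finset.mem_product] at h ⊢
      exact ⟨mix_mem_blk j h.1 h.2, mix_mem_blk j h.2 h.1⟩
    · rintro ⟨a, b⟩ h
      rw [Finset.mem_product] at h ⊢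
      exact ⟨mix_mem_blk j h.1 h.2, mix_mem_blk j h.2 h.1⟩
    · rintro ⟨a, b⟩ -
      ext i <;> simp only [mix] <;> split_ifs <;> rfl
    · rintro ⟨a, b⟩ -
      ext i <;> simp only [mix] <;> split_ifs <;> rfl
    · rintro ⟨a, b⟩ -
      rfl
  rw [this]
  simp [card_blk, Finset.mul_sum]

lemma sum_line {d : ℕ} (F : (Fin d → ℤ) → ℝ) (k : ℕ) (x : Fin d → ℤ) (i : Fin d) :
    ∑ w ∈ blk k x, ∑ t ∈ Finset.Ico (2 ^ k * (x i / 2 ^ k)) (2 ^ k * (x i / 2 ^ k) + 2 ^ k - 1),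
        F (Function.update w i t) =
      2 ^ k * ∑ y ∈ blk k x, if y + Pi.single i 1 ∈ blk k x then F y else 0 := by
  set a := 2 ^ k * (x i / 2 ^ k) with ha
  have h1 : (2:ℝ) ^ k * ∑ y ∈ blk k x, (if y + Pi.single i 1 ∈ blk k x then F y else 0) =
      ∑ y ∈ (blk k x).filter (fun y => y + Pi.single i 1 ∈ blk k x),
        ∑ s ∈ Finset.Ico a (a + 2 ^ k), F y := by
    rw [← Finset.sum_filter]
    simp [Finset.mul_sum, toNat_two_pow]
  have hmem : ∀ y : Fin d → ℤ, y ∈ blk k x ↔ ∀ j, 2 ^ k * (x j / 2 ^ k) ≤ y j ∧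
      y j < 2 ^ k * (x j / 2 ^ k) + 2 ^ k := by
    intro y; simp [blk]
  rw [h1, ← Finset.sum_product', ← Finset.sum_product']
  refine Finset.sum_nbij' (fun p => (Function.update p.1 i p.2, p.1 i))
      (fun p => (Function.update p.1 i p.2, p.1 i)) ?_ ?_ ?_ ?_ ?_
  · rintro ⟨w, t⟩ h
    simp only [Finset.mem_product, Finset.mem_filter, Finset.mem_Ico, hmem] at h ⊢
    obtain ⟨h1, h2, h3⟩ := h
    refine ⟨⟨?_, ?_⟩, (h1 i).1, (h1 i).2⟩
    · intro j
      rcases eq_or_ne j i with rfl | hj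
      · simp; omega
      · simpa [hj] using h1 j
    · intro j
      rcases eq_or_ne j i with rfl | hj
      · simp; omega
      · simpa [hj] using h1 j
  · rintro ⟨y, s⟩ h
    simp only [Finset.mem_product, Finset.mem_filter, Finset.mem_Ico, hmem] at h ⊢
    obtain ⟨⟨h1, h2⟩, h3, h4⟩ := h
    refine ⟨?_, (h1 i).1, ?_⟩
    · intro j
      rcases eq_or_ne j i with rfl | hj
      · simp; omega
      · simpa [hj] using h1 j
    · have := (h2 i).2
      simp at this
      omega
  · rintro ⟨w, t⟩ -
    simp
  · rintro ⟨w, t⟩ -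
    simp
  · rintro ⟨w, t⟩ -
    rfl

/-- The variation of `u` along the line in direction `i` through `w`, inside the block around `x`. -/
def lineVar {d : ℕ} (u : (Fin d → ℤ) → ℝ) (k : ℕ) (x : Fin d → ℤ) (i : Fin d)
    (w : Fin d → ℤ) : ℝ :=
  ∑ t ∈ Finset.Ico (2 ^ k * (x i / 2 ^ k)) (2 ^ k * (x i / 2 ^ k) + 2 ^ k - 1),
    |u (Function.update w i t) - u (Function.update w i t + Pi.single i 1)|

lemma abs_sub_le_lineVar {d : ℕ} (u : (Fin d → ℤ) → ℝ) (k : ℕ) (x : Fin d → ℤ) (i : Fin d)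
    {w w' : Fin d → ℤ} (hw : w ∈ blk k x) (hw' : w' ∈ blk k x) (hne : ∀ j, j ≠ i → w' j = w j) :
    |u w - u w'| ≤ lineVar u k x i w := by
  have hmem : ∀ y : Fin d → ℤ, y ∈ blk k x ↔ ∀ j, 2 ^ k * (x j / 2 ^ k) ≤ y j ∧
      y j < 2 ^ k * (x j / 2 ^ k) + 2 ^ k := by
    intro y; simp [blk]
  have hv : ∀ t : ℤ, Function.update w i t + Pi.single i 1 = Function.update w i (t + 1) := by
    intro t
    ext j
    rcases eq_or_ne j i with rfl | hj
    · simp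
    · simp [hj]
  have hw1 : Function.update w i (w i) = w := by simp
  have hw2 : Function.update w i (w' i) = w' := by
    ext j
    rcases eq_or_ne j i with rfl | hj
    · simp
    · simp [hj, hne j hj]
  simp only [lineVar, hv]
  have h1 := (hmem w).1 hw i
  have h2 := (hmem w').1 hw' i
  rcases le_total (w i) (w' i) with h | h
  · have := abs_sub_le_sum_Ico (fun t => u (Function.update w i t)) h1.1 h h2.2
    simpa only [hw1, hw2] using this
  · have := abs_sub_le_sum_Ico (fun t => u (Function.update w i t)) h2.1 h h1.2
    rw [abs_sub_comm (u w)]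
    simpa only [hw1, hw2] using this

lemma abs_sub_le_sum_lineVar {d : ℕ} (u : (Fin d → ℤ) → ℝ) (k : ℕ) {x y z : Fin d → ℤ}
    (hy : y ∈ blk k x) (hz : z ∈ blk k x) :
    |u y - u z| ≤ ∑ i : Fin d, lineVar u k x i (mix i y z) := by
  have h0 : mix 0 y z = y := by ext i; simp [mix]
  have hd : mix d y z = z := by ext i; simp [mix]
  have htel : u y - u z =
      ∑ i : Fin d, (u (mix (i : ℕ) y z) - u (mix ((i : ℕ) + 1) y z)) := by
    rw [Fin.sum_univ_eq_sum_range (fun n => u (mix n y z) - u (mix (n + 1) y z)),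
      Finset.sum_range_sub', h0, hd]
  rw [htel]
  refine (Finset.abs_sum_le_sum_abs _ _).trans (Finset.sum_le_sum fun i _ => ?_)
  refine abs_sub_le_lineVar u k x i (mix_mem_blk _ hy hz) (mix_mem_blk _ hy hz) fun j hj => ?_
  have : (j : ℕ) ≠ i := fun h => hj (Fin.ext h)
  simp only [mix]
  split_ifs <;> first | rfl | omega

/-- The Poincaré inequality on a lattice cube. -/
lemma lattice_poincare {d : ℕ} (u : (Fin d → ℤ) → ℝ) (k : ℕ) (x : Fin d → ℤ) :
    ∑ y ∈ blk k x, ∑ z ∈ blk k x, |u y - u z| ≤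
      2 ^ k * ((2 ^ d) ^ k * ∑ y ∈ blk k x, edgeVar k u y) := by
  have hL : ∀ i, ∑ y ∈ blk k x, ∑ z ∈ blk k x, lineVar u k x i (mix i y z) =
      (2 ^ d) ^ k * (2 ^ k * ∑ y ∈ blk k x,
      if y + Pi.single i 1 ∈ blk k x then |u y - u (y + Pi.single i 1)| else 0) := fun i => by
    have h := sum_line (fun y => |u y - u (y + Pi.single i 1)|) k x i
    have h2 := sum_mix (lineVar u k x i) k i x
    rw [h2]
    rw [← h]
    simp only [lineVar]
  have h1 : ∑ y ∈ blk k x, edgeVar k u y = ∑ i : Fin d, ∑ y ∈ blk k x,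
      if y + Pi.single i 1 ∈ blk k x then |u y - u (y + Pi.single i 1)| else 0 := by
    rw [Finset.sum_comm]
    exact Finset.sum_congr rfl fun y hy => by rw [edgeVar, blk_eq hy]
  calc ∑ y ∈ blk k x, ∑ z ∈ blk k x, |u y - u z|
      ≤ ∑ y ∈ blk k x, ∑ z ∈ blk k x, ∑ i : Fin d, lineVar u k x i (mix i y z) :=
        Finset.sum_le_sum fun y hy => Finset.sum_le_sum fun z hz =>
          abs_sub_le_sum_lineVar u k hy hz
    _ = ∑ i : Fin d, ∑ y ∈ blk k x, ∑ z ∈ blk k x, lineVar u k x i (mix i y z) := by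
        simp_rw [Finset.sum_comm (s := blk k x) (t := (Finset.univ : Finset (Fin d)))]
    _ = 2 ^ k * ((2 ^ d) ^ k * ∑ y ∈ blk k x, edgeVar k u y) := by
        rw [h1, Finset.sum_congr rfl fun i _ => hL i, ← Finset.mul_sum, ← Finset.mul_sum,
          mul_left_comm]

/-- The running maximum of `m` and the averages of `g` over the strict ancestors, up to level `K`,
of the block of side `2 ^ k` around `x`. -/
def runMax {d : ℕ} (g : (Fin d → ℤ) → ℝ) (m : ℝ) (K k : ℕ) (x : Fin d → ℤ) : ℝ :=
  (Finset.Ioc k K).fold max m fun j => bavg g j x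

lemma runMax_step {d : ℕ} (g : (Fin d → ℤ) → ℝ) (m : ℝ) {K k : ℕ} (hk : k < K)
    (x : Fin d → ℤ) :
    runMax g m K k x = max (runMax g m K (k + 1) x) (bavg g (k + 1) x) := by
  have : Finset.Ioc k K = insert (k + 1) (Finset.Ioc (k + 1) K) := by
    ext z; simp only [Finset.mem_Ioc, Finset.mem_insert]; omega
  rw [runMax, this, Finset.fold_insert (by simp), max_comm, ← runMax]

lemma runMax_congr {d : ℕ} (g : (Fin d → ℤ) → ℝ) (m : ℝ) {K k : ℕ} {x y : Fin d → ℤ}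
    (h : y ∈ blk k x) : runMax g m K k y = runMax g m K k x := by
  refine Finset.fold_congr fun j hj => bavg_congr g ?_
  exact blk_mono (Finset.mem_Ioc.1 hj).1.le x h

lemma runMax_le {d : ℕ} {g : (Fin d → ℤ) → ℝ} {m : ℝ} {K k : ℕ} {x : Fin d → ℤ} {t : ℝ}
    (hm : m ≤ t) (h : ∀ j, k < j → j ≤ K → bavg g j x ≤ t) : runMax g m K k x ≤ t := by
  rw [runMax, Finset.fold_max_le]
  exact ⟨hm, fun j hj => h j (Finset.mem_Ioc.1 hj).1 (Finset.mem_Ioc.1 hj).2⟩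

lemma runMax_anti {d : ℕ} (g : (Fin d → ℤ) → ℝ) (m : ℝ) {K j k : ℕ} (hjk : j < k) (hk : k ≤ K)
    (x : Fin d → ℤ) : max (runMax g m K k x) (bavg g k x) ≤ runMax g m K j x := by
  have h : ∀ i, j < i → i ≤ K → bavg g i x ≤ runMax g m K j x := fun i h1 h2 => by
    rw [runMax, Finset.le_fold_max]
    exact Or.inr ⟨i, Finset.mem_Ioc.2 ⟨h1, h2⟩, le_rfl⟩
  refine max_le (runMax_le ?_ fun i h1 h2 => h i (by omega) h2) (h k hjk hk)
  rw [runMax, Finset.le_fold_max]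
  exact Or.inl le_rfl

/-- The length of the part of `(a, b]` below `t`, up to the constant `min t a`. -/
def slice (a b t : ℝ) : ℝ := min t b - min t a

lemma abs_slice_sub {a b : ℝ} (hab : a ≤ b) (s t : ℝ) :
    |slice a b s - slice a b t| = |min t b - min s b| - |min t a - min s a| := by
  wlog h : s ≤ t generalizing s t
  · rw [abs_sub_comm, abs_sub_comm (min t b), abs_sub_comm (min t a)]
    exact this t s (le_of_not_ge h)
  have h1 : slice a b s ≤ slice a b t := by
    simp only [slice, min_def]; split_ifs <;> linarith
  have h2 : ∀ w, min s w ≤ min t w := fun w => min_le_min_right w h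
  rw [abs_of_nonpos (by linarith), abs_of_nonneg (by linarith [h2 b]),
    abs_of_nonneg (by linarith [h2 a])]
  simp only [slice]
  ring

/-- The number of points of the block with `p`, as a real number. -/
lemma card_filter_eq {d : ℕ} (p : (Fin d → ℤ) → Prop) [DecidablePred p] (k : ℕ)
    (x : Fin d → ℤ) :
    (((blk k x).filter p).card : ℝ) = (2 ^ d) ^ k * bavg (fun y => if p y then 1 else 0) k x := by
  rw [← sum_blk_eq]
  simp

open Classical in
/-- If `g` is at most `a` on half of a block and at least `b` on a fixed fraction of it, then the
variation of `g` between the levels `a` and `b` is large. -/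
lemma sub_le_edgeVar {d : ℕ} (g : (Fin d → ℤ) → ℝ) (k : ℕ) (x : Fin d → ℤ) {a a' b b' c : ℝ}
    (hc : 0 < c) (ha : a' ≤ a) (hab : a ≤ b) (hb : b ≤ b')
    (h1 : bavg (fun y => if a < g y then 1 else 0) k x ≤ 1 / 2)
    (h2 : c ≤ bavg (fun y => if b ≤ g y then 1 else 0) k x) :
    b - a ≤ 2 / c * 2 ^ k * bavg (edgeVar k fun y => slice a' b' (g y)) k x := by
  have hP := lattice_poincare (fun y => slice a' b' (g y)) k x
  have h1' : 1 / 2 ≤ bavg (fun y => if g y ≤ a then 1 else 0) k x := by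
    have := bavg_add (fun y => if a < g y then 1 else 0) (fun y => if g y ≤ a then 1 else 0) k x
    have h : (fun y => (if a < g y then (1:ℝ) else 0) + (if g y ≤ a then 1 else 0)) =
        fun _ => 1 := by
      ext y
      rcases lt_or_ge a (g y) with h | h
      · simp [h]
      · simp [h, not_lt.2 h]
    rw [h, bavg_const] at this
    linarith
  have hpt : ∀ y z, (if g y ≤ a then (1:ℝ) else 0) * ((if b ≤ g z then 1 else 0) * (b - a)) ≤
      |slice a' b' (g y) - slice a' b' (g z)| := by
    intro y z
    split_ifs with hy hz
    · rw [abs_sub_comm]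
      refine le_trans ?_ (le_abs_self _)
      simp only [slice, min_def]
      split_ifs <;> linarith
    all_goals simp
  have hlow : ((2 ^ d) ^ k * bavg (fun y => if g y ≤ a then 1 else 0) k x) *
      (((2 ^ d) ^ k * bavg (fun y => if b ≤ g y then 1 else 0) k x) * (b - a)) ≤
      ∑ y ∈ blk k x, ∑ z ∈ blk k x, |slice a' b' (g y) - slice a' b' (g z)| := by
    rw [← sum_blk_eq, ← sum_blk_eq, Finset.sum_mul (blk k x) _ (b - a), Finset.sum_mul_sum]
    exact Finset.sum_le_sum fun y _ => Finset.sum_le_sum fun z _ => hpt y z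
  rw [sum_blk_eq (edgeVar k _)] at hP
  have hN : (0:ℝ) < (2 ^ d) ^ k := by positivity
  set N : ℝ := (2 ^ d) ^ k
  have h3 : (N * (1 / 2)) * ((N * c) * (b - a)) ≤
      N * bavg (fun y => if g y ≤ a then 1 else 0) k x *
        (N * bavg (fun y => if b ≤ g y then 1 else 0) k x * (b - a)) := by
    have : 0 ≤ b - a := by linarith
    gcongr
  have h4 := (h3.trans hlow).trans hP
  set V := bavg (edgeVar k fun y => slice a' b' (g y)) k x
  have h5 : N ^ 2 * (c / 2 * (b - a)) ≤ N ^ 2 * (2 ^ k * V) := by nlinarith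
  have h6 := le_of_mul_le_mul_left h5 (by positivity)
  calc b - a = 2 / c * (c / 2 * (b - a)) := by field_simp
    _ ≤ 2 / c * (2 ^ k * V) := by gcongr
    _ = _ := by ring

/-- The variation of `g` at `y` inside its block of side `2 ^ k`, between the levels given by the
averages over the strict ancestors and over the block itself. -/
def levelVar {d : ℕ} (g : (Fin d → ℤ) → ℝ) (m : ℝ) (K k : ℕ) (y : Fin d → ℤ) : ℝ :=
  edgeVar k
    (fun z => slice (runMax g m K k y) (max (runMax g m K k y) (bavg g k y)) (g z)) y

lemma bavg_levelVar {d : ℕ} (g : (Fin d → ℤ) → ℝ) (m : ℝ) (K k : ℕ) (x : Fin d → ℤ) :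
    bavg (levelVar g m K k) k x = bavg (edgeVar k fun z =>
      slice (runMax g m K k x) (max (runMax g m K k x) (bavg g k x)) (g z)) k x := by
  have h : ∀ y ∈ blk k x, levelVar g m K k y = edgeVar k (fun z =>
      slice (runMax g m K k x) (max (runMax g m K k x) (bavg g k x)) (g z)) y := fun y hy => by
    rw [levelVar, runMax_congr g m hy, bavg_congr g hy]
  exact le_antisymm (bavg_mono fun y hy => (h y hy).le) (bavg_mono fun y hy => (h y hy).ge)

lemma sum_levelVar_le {d : ℕ} (g : (Fin d → ℤ) → ℝ) (m : ℝ) (K : ℕ) (y : Fin d → ℤ) :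
    ∑ k ∈ Finset.range (K + 1), levelVar g m K k y ≤ edgeVar K g y := by
  unfold levelVar edgeVar
  rw [Finset.sum_comm]
  refine Finset.sum_le_sum fun i _ => ?_
  set z := y + Pi.single i 1
  split_ifs with hz
  · let H : ℝ → ℝ := fun w => |min (g z) w - min (g y) w|
    have hmono : ∀ a b, a ≤ b → |slice a b (g y) - slice a b (g z)| = H b - H a := by
      exact fun a b hab => abs_slice_sub hab _ _
    have hH0 : ∀ w, 0 ≤ H w := fun w => abs_nonneg _
    have hH1 : ∀ w, H w ≤ |g y - g z| := by
      intro w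
      simp only [H]
      rw [abs_sub_comm]
      exact (abs_min_sub_min_le_max _ _ _ _).trans (by simp)
    have hterm : ∀ k, (if z ∈ blk k y then |slice (runMax g m K k y)
        (max (runMax g m K k y) (bavg g k y)) (g y) - slice (runMax g m K k y)
        (max (runMax g m K k y) (bavg g k y)) (g z)| else 0) ≤
        H (max (runMax g m K k y) (bavg g k y)) - H (runMax g m K k y) := by
      intro k
      rw [← hmono _ _ (le_max_left _ _)]
      split_ifs
      exacts [le_rfl, abs_nonneg _]
    refine (Finset.sum_le_sum fun k _ => hterm k).trans ?_
    have htel : ∀ n, n ≤ K → ∑ k ∈ Finset.range (n + 1),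
        (H (max (runMax g m K k y) (bavg g k y)) - H (runMax g m K k y)) =
        H (max (runMax g m K 0 y) (bavg g 0 y)) - H (runMax g m K n y) := by
      intro n
      induction n with
      | zero => simp
      | succ n ih =>
        intro hn
        rw [Finset.sum_range_succ, ih (by omega), runMax_step g m (by omega : n < K)]
        ring
    rw [htel K le_rfl]
    have := hH0 (runMax g m K K y)
    have := hH1 (max (runMax g m K 0 y) (bavg g 0 y))
    linarith
  · refine (Finset.sum_eq_zero fun k hk => ?_).le
    rw [if_neg]
    exact fun h => hz (blk_mono (by simpa [Nat.lt_succ_iff] using hk) y h)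

lemma levelVar_nonneg {d : ℕ} (g : (Fin d → ℤ) → ℝ) (m : ℝ) (K k : ℕ) (y : Fin d → ℤ) :
    0 ≤ levelVar g m K k y := edgeVar_nonneg _ _ _

/-- A geometric absorption argument. -/
lemma sum_geometric_absorb (A V : ℕ → ℝ) (K : ℕ) (hA : ∀ k, 0 ≤ A k) (hV : ∀ k, 0 ≤ V k)
    (h0 : A 0 ≤ 0)
    (h : ∀ k, k < K → 7 / 8 * A (k + 1) ≤
      ∑ i ∈ Finset.range (k + 1), (A i + V i) - 7 / 8 * (A k + V k)) :
    ∑ k ∈ Finset.range (K + 1), A k / 2 ^ k ≤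
      2 * ∑ k ∈ Finset.range (K + 1), V k / 2 ^ k := by
  have key : ∀ n, n ≤ K → ∑ k ∈ Finset.range (n + 1), 7 / 8 * (A k / 2 ^ k) +
      (∑ i ∈ Finset.range (n + 1), (A i + V i)) / 2 ^ n - 7 / 8 * (A n + V n) / 2 ^ (n + 1) ≤
      9 / 16 * ∑ i ∈ Finset.range (n + 1), (A i + V i) / 2 ^ i := by
    intro n
    induction n with
    | zero => 
      intro _
      have := hA 0
      simp
      linarith
    | succ n ih =>
      intro hn
      have h1 := ih (by omega)
      have h2 := h n (by omega)
      rw [Finset.sum_range_succ (fun k => 7 / 8 * (A k / 2 ^ k)) (n + 1),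
        Finset.sum_range_succ (fun i => A i + V i) (n + 1),
        Finset.sum_range_succ (fun i => (A i + V i) / 2 ^ i) (n + 1)]
      set S := ∑ i ∈ Finset.range (n + 1), (A i + V i)
      have h3 : 7 / 8 * A (n + 1) / 2 ^ (n + 1) ≤ (S - 7 / 8 * (A n + V n)) / 2 ^ (n + 1) := by
        gcongr
      have e1 : (S + (A (n + 1) + V (n + 1))) / 2 ^ (n + 1) =
          S / 2 ^ (n + 1) + (A (n + 1) + V (n + 1)) / 2 ^ (n + 1) := add_div _ _ _
      have e2 : 7 / 8 * (A (n + 1) + V (n + 1)) / 2 ^ (n + 1 + 1) =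
          7 / 16 * ((A (n + 1) + V (n + 1)) / 2 ^ (n + 1)) := by
        rw [pow_succ 2 (n + 1)]; field_simp; ring
      have e3 : S / 2 ^ n = 2 * (S / 2 ^ (n + 1)) := by
        rw [pow_succ 2 n]; field_simp
      rw [sub_div] at h3
      rw [e1, e2]
      rw [e3] at h1
      have e4 : 7 / 8 * (A (n + 1) / 2 ^ (n + 1)) = 7 / 8 * A (n + 1) / 2 ^ (n + 1) := by ring
      linarith
  have h1 := key K le_rfl
  have h2 : 0 ≤ (∑ i ∈ Finset.range (K + 1), (A i + V i)) / 2 ^ K -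
      7 / 8 * (A K + V K) / 2 ^ (K + 1) := by
    have e1 : A K + V K ≤ ∑ i ∈ Finset.range (K + 1), (A i + V i) :=
      Finset.single_le_sum (f := fun i => A i + V i) (fun i _ => add_nonneg (hA i) (hV i))
        (Finset.self_mem_range_succ K)
    have e2 : 7 / 8 * (A K + V K) / 2 ^ (K + 1) = 7 / 16 * ((A K + V K) / 2 ^ K) := by
      rw [pow_succ]; field_simp; ring
    have e3 : (A K + V K) / 2 ^ K ≤ (∑ i ∈ Finset.range (K + 1), (A i + V i)) / 2 ^ K := by
      gcongr
    have e4 : 0 ≤ (A K + V K) / 2 ^ K := div_nonneg (add_nonneg (hA K) (hV K)) (by positivity)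
    linarith
  have h3 : ∑ i ∈ Finset.range (K + 1), (A i + V i) / 2 ^ i =
      ∑ i ∈ Finset.range (K + 1), A i / 2 ^ i + ∑ i ∈ Finset.range (K + 1), V i / 2 ^ i := by
    simp [add_div, Finset.sum_add_distrib]
  rw [← Finset.mul_sum] at h1
  have h4 : 0 ≤ ∑ i ∈ Finset.range (K + 1), V i / 2 ^ i :=
    Finset.sum_nonneg fun i _ => div_nonneg (hV i) (by positivity)
  linarith

/-- The density at which the thresholds are chosen. -/
def dens (d : ℕ) : ℝ := 1 / (16 * (2 ^ d * 2 ^ d))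

lemma dens_pos (d : ℕ) : 0 < dens d := by unfold dens; positivity

lemma two_pow_mul_dens (d : ℕ) : 2 ^ d * dens d ≤ 1 / 16 := by
  have h : (1:ℝ) ≤ 2 ^ d := one_le_pow₀ (by norm_num)
  have : 2 ^ d * dens d = 1 / (16 * 2 ^ d) := by unfold dens; field_simp
  rw [this]
  gcongr
  linarith

lemma dens_le (d : ℕ) : dens d ≤ 1 / 16 := by
  have h : (1:ℝ) ≤ 2 ^ d := one_le_pow₀ (by norm_num)
  nlinarith [two_pow_mul_dens d, dens_pos d]

/-- The threshold of the block of side `2 ^ k` around `x`. -/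
def thr {d : ℕ} (g : (Fin d → ℤ) → ℝ) (m : ℝ) (K k : ℕ) (x : Fin d → ℤ) : ℝ :=
  (exists_threshold (blk k x) g (runMax g m K k x) (dens_pos d).le).choose

lemma thr_congr {d : ℕ} (g : (Fin d → ℤ) → ℝ) (m : ℝ) {K k : ℕ} {x y : Fin d → ℤ}
    (h : y ∈ blk k x) : thr g m K k y = thr g m K k x := by
  have : ∀ (S S' : Finset (Fin d → ℤ)) (a a' : ℝ), S = S' → a = a' →
      (exists_threshold S g a (dens_pos d).le).choose =
        (exists_threshold S' g a' (dens_pos d).le).choose := by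
    rintro S S' a a' rfl rfl; rfl
  exact this _ _ _ _ (blk_eq h) (runMax_congr g m h)

lemma runMax_le_thr {d : ℕ} (g : (Fin d → ℤ) → ℝ) (m : ℝ) (K k : ℕ) (x : Fin d → ℤ) :
    runMax g m K k x ≤ thr g m K k x :=
  (exists_threshold (blk k x) g (runMax g m K k x) (dens_pos d).le).choose_spec.1

lemma bavg_thr_le {d : ℕ} (g : (Fin d → ℤ) → ℝ) (m : ℝ) (K k : ℕ) (x : Fin d → ℤ) :
    bavg (fun y => if thr g m K k x < g y then 1 else 0) k x ≤ dens d := by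
  have h : (((blk k x).filter fun y => thr g m K k x < g y).card : ℝ) ≤ dens d * (blk k x).card :=
    (exists_threshold (blk k x) g (runMax g m K k x) (dens_pos d).le).choose_spec.2.1
  rw [card_filter_eq, card_blk, mul_comm (dens d)] at h
  push_cast at h
  exact le_of_mul_le_mul_left h (by positivity)

lemma thr_eq_or {d : ℕ} (g : (Fin d → ℤ) → ℝ) (m : ℝ) (K k : ℕ) (x : Fin d → ℤ) :
    thr g m K k x = runMax g m K k x ∨
      dens d ≤ bavg (fun y => if thr g m K k x ≤ g y then 1 else 0) k x := by
  have h : thr g m K k x = runMax g m K k x ∨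
      dens d * (blk k x).card ≤ (((blk k x).filter fun y => thr g m K k x ≤ g y).card : ℝ) :=
    (exists_threshold (blk k x) g (runMax g m K k x) (dens_pos d).le).choose_spec.2.2
  rw [card_filter_eq, card_blk, mul_comm (dens d)] at h
  push_cast at h
  exact h.imp id fun h => le_of_mul_le_mul_left h (by positivity)

/-- The excess of the average over the threshold. -/
def excess {d : ℕ} (g : (Fin d → ℤ) → ℝ) (m : ℝ) (K k : ℕ) (x : Fin d → ℤ) : ℝ :=
  max 0 (bavg g k x - thr g m K k x)

lemma excess_nonneg {d : ℕ} (g : (Fin d → ℤ) → ℝ) (m : ℝ) (K k : ℕ) (x : Fin d → ℤ) :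
    0 ≤ excess g m K k x := le_max_left _ _

/-- The normalized variation between the levels of a block. -/
def blkVar {d : ℕ} (g : (Fin d → ℤ) → ℝ) (m : ℝ) (K k : ℕ) (x : Fin d → ℤ) : ℝ :=
  2 / dens d * 2 ^ k * bavg (levelVar g m K k) k x

lemma blkVar_nonneg {d : ℕ} (g : (Fin d → ℤ) → ℝ) (m : ℝ) (K k : ℕ) (x : Fin d → ℤ) :
    0 ≤ blkVar g m K k x := by
  have := bavg_nonneg (levelVar_nonneg g m K k) k x
  have := dens_pos d
  unfold blkVar
  positivity

lemma sub_le_excess_add {d : ℕ} (g : (Fin d → ℤ) → ℝ) (m : ℝ) (K k : ℕ) (x : Fin d → ℤ) {l : ℝ}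
    (hl : runMax g m K k x ≤ l) (h : bavg (fun y => if l < g y then 1 else 0) k x ≤ 1 / 2) :
    bavg g k x - l ≤ excess g m K k x + blkVar g m K k x := by
  have hv := blkVar_nonneg g m K k x
  have he := excess_nonneg g m K k x
  have he' : bavg g k x - thr g m K k x ≤ excess g m K k x := le_max_right _ _
  rcases le_or_gt (bavg g k x) l with h1 | h1
  · linarith
  rcases le_or_gt (thr g m K k x) l with h2 | h2
  · linarith
  rcases thr_eq_or g m K k x with h3 | h3
  · linarith
  have := sub_le_edgeVar g k x (dens_pos d) hl (le_min h2.le h1.le)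
    ((min_le_right (thr g m K k x) _).trans (le_max_right (runMax g m K k x) _)) h
    (h3.trans (bavg_mono fun y _ => by
      split_ifs with h4 h5 h5
      · exact le_rfl
      · exact absurd ((min_le_left _ _).trans h4) h5
      · exact zero_le_one
      · exact le_rfl))
  rw [← bavg_levelVar, ← blkVar] at this
  rcases min_cases (thr g m K k x) (bavg g k x) with h4 | h4 <;> linarith

/-- The increment of the running maximum at level `k`. -/
def incr {d : ℕ} (g : (Fin d → ℤ) → ℝ) (m : ℝ) (K k : ℕ) (x : Fin d → ℤ) : ℝ :=
  max 0 (bavg g k x - runMax g m K k x)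

lemma bavg_le_sum_incr {d : ℕ} (g : (Fin d → ℤ) → ℝ) (m : ℝ) {K n : ℕ} (hn : n < K)
    (y : Fin d → ℤ) {j : ℕ} (hj : j ≤ n) :
    max (runMax g m K j y) (bavg g j y) =
      runMax g m K n y + ∑ i ∈ Finset.Ico j (n + 1), incr g m K i y := by
  have hstep : ∀ i, max (runMax g m K i y) (bavg g i y) = runMax g m K i y + incr g m K i y := by
    intro i
    rw [incr, ← max_add_add_left]
    simp
  induction hj using Nat.decreasingInduction with
  | self => simp [hstep]
  | of_succ j hj ih =>
    rw [hstep, runMax_step g m (by omega : j < K), ih,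
      Finset.sum_eq_sum_Ico_succ_bot (by omega : j < n + 1)]
    ring

/-- `j` is the largest level below `k` at which the density of `I` around `y` is at least `κ`. -/
def IsTopLevel {d : ℕ} (I : (Fin d → ℤ) → ℝ) (κ : ℝ) (k j : ℕ) (y : Fin d → ℤ) : Prop :=
  κ ≤ bavg I j y ∧ ∀ i, j < i → i < k → bavg I i y < κ

lemma IsTopLevel.congr {d : ℕ} {I : (Fin d → ℤ) → ℝ} {κ : ℝ} {k j : ℕ} {y z : Fin d → ℤ}
    (h : IsTopLevel I κ k j y) (hz : z ∈ blk j y) : IsTopLevel I κ k j z := by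
  refine ⟨by rw [bavg_congr I hz]; exact h.1, fun i h1 h2 => ?_⟩
  rw [bavg_congr I (blk_mono h1.le y hz)]
  exact h.2 i h1 h2

lemma IsTopLevel.unique {d : ℕ} {I : (Fin d → ℤ) → ℝ} {κ : ℝ} {k j j' : ℕ} {y : Fin d → ℤ}
    (h : IsTopLevel I κ k j y) (h' : IsTopLevel I κ k j' y) (hj : j < k) (hj' : j' < k) : j = j' := by
  rcases lt_trichotomy j j' with hlt | heq | hlt
  · exact absurd h'.1 (not_le.2 (h.2 _ hlt hj'))
  · exact heq
  · exact absurd h.1 (not_le.2 (h'.2 _ hlt hj))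

lemma exists_isTopLevel {d : ℕ} {I : (Fin d → ℤ) → ℝ} {κ : ℝ} {k : ℕ} {y : Fin d → ℤ} (hk : 0 < k)
    (h : κ ≤ I y) : ∃ j < k, IsTopLevel I κ k j y := by
  classical
  let T := (Finset.range k).filter fun j => κ ≤ bavg I j y
  have hT : T.Nonempty := ⟨0, by simp [T, hk, bavg_zero, h]⟩
  obtain ⟨h1, h2⟩ := Finset.mem_filter.1 (T.max'_mem hT)
  refine ⟨T.max' hT, Finset.mem_range.1 h1, h2, fun i h3 h4 => ?_⟩
  by_contra! h5
  have := T.le_max' i (Finset.mem_filter.2 ⟨Finset.mem_range.2 h4, h5⟩)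
  omega

open Classical in
/-- Sums over a block are decomposed according to the top level. -/
lemma sum_ite_isTopLevel {d : ℕ} (u : (Fin d → ℤ) → ℝ) (I : (Fin d → ℤ) → ℝ) (κ : ℝ) {k j : ℕ}
    (hj : j < k) (x : Fin d → ℤ) :
    ∑ y ∈ blk k x, (if IsTopLevel I κ k j y then bavg u j y else 0) =
      ∑ y ∈ blk k x, if IsTopLevel I κ k j y then u y else 0 := by
  rw [← Finset.sum_filter, ← Finset.sum_filter]
  refine sum_bavg u j _ fun y hy z hz => ?_
  rw [Finset.mem_filter] at hy ⊢
  exact ⟨blk_subset_blk hj.le hy.1 hz, hy.2.congr hz⟩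

open Classical in
/-- Bound for the excess in terms of the smaller levels. -/
lemma excess_le {d : ℕ} (g : (Fin d → ℤ) → ℝ) (m : ℝ) {K n : ℕ} (hn : n < K) (x : Fin d → ℤ) :
    7 / 8 * excess g m K (n + 1) x ≤
      ∑ i ∈ Finset.range (n + 1), bavg (fun y => excess g m K i y + blkVar g m K i y) (n + 1) x -
        7 / 8 * bavg (fun y => excess g m K n y + blkVar g m K n y) (n + 1) x := by
  set W : ℕ → (Fin d → ℤ) → ℝ := fun i y => excess g m K i y + blkVar g m K i y with hW
  have hW0 : ∀ i y, 0 ≤ W i y := fun i y =>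
    add_nonneg (excess_nonneg g m K i y) (blkVar_nonneg g m K i y)
  change _ ≤ ∑ i ∈ Finset.range (n + 1), bavg (W i) (n + 1) x - 7 / 8 * bavg (W n) (n + 1) x
  rcases (excess_nonneg g m K (n + 1) x).eq_or_lt with h0 | h0
  · rw [← h0, Finset.sum_range_succ]
    have := bavg_nonneg (hW0 n) (n + 1) x
    have : 0 ≤ ∑ i ∈ Finset.range n, bavg (W i) (n + 1) x :=
      Finset.sum_nonneg fun i _ => bavg_nonneg (hW0 i) _ _
    linarith
  set k := n + 1 with hk
  set l := thr g m K k x with hl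
  have hα : excess g m K k x = bavg g k x - l := by
    rcases max_cases 0 (bavg g k x - l) with h | h
    · exact absurd h.1 h0.ne'
    · exact h.1
  have hgl : l < bavg g k x := by linarith
  set α := excess g m K k x with hαdef
  set I : (Fin d → ℤ) → ℝ := fun y => if l < g y then 1 else 0 with hI
  have hI0 : ∀ y, 0 ≤ I y := fun y => by simp only [hI]; split_ifs <;> norm_num
  have hIk : bavg I k x ≤ dens d := bavg_thr_le g m K k x
  set κ : ℝ := 1 / (2 * 2 ^ d) with hκ
  have hd1 : (1:ℝ) ≤ 2 ^ d := one_le_pow₀ (by norm_num)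
  have hκ0 : 0 < κ := by positivity
  have hκ1 : 2 ^ d * κ = 1 / 2 := by rw [hκ]; field_simp
  have hκ2 : κ ≤ 1 / 2 := by nlinarith
  let P : ℕ → (Fin d → ℤ) → Prop := fun j y => IsTopLevel I κ k j y
  let F : (Fin d → ℤ) → ℝ := fun y => ∑ j ∈ Finset.range k, if P j y then 1 else 0
  -- the decomposition of a quantity along the top level
  have hsum : ∀ (j : ℕ) (y) (q : ℕ → ℝ), j < k → P j y →
      ∑ i ∈ Finset.range k, (if P i y then q i else 0) = q j := by
    intro j y q hj hP
    rw [Finset.sum_eq_single j]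
    · rw [if_pos hP]
    · intro i hi hne
      rw [if_neg]
      exact fun h => hne (h.unique hP (Finset.mem_range.1 hi) hj)
    · exact fun h => absurd (Finset.mem_range.2 hj) h
  have hsum0 : ∀ (y) (q : ℕ → ℝ), (¬ ∃ j < k, P j y) →
      ∑ i ∈ Finset.range k, (if P i y then q i else 0) = 0 := by
    intro y q h
    refine Finset.sum_eq_zero fun i hi => if_neg fun hP => h ⟨i, Finset.mem_range.1 hi, hP⟩
  have hF0 : ∀ y, 0 ≤ F y := fun y => Finset.sum_nonneg fun j _ => by split_ifs <;> norm_num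
  have hbound : ∀ y ∈ blk k x, ∀ j < k, P j y →
      bavg g j y - l ≤ α + ∑ i ∈ Finset.range n, W i y + W n y := by
    intro y hy j hj hP
    have hMk : runMax g m K n y = bavg g k x := by
      rw [runMax_step g m hn, ← hk, runMax_congr g m hy, bavg_congr g hy]
      exact max_eq_right ((runMax_le_thr g m K k x).trans hgl.le)
    have h1 := bavg_le_sum_incr g m hn y (by omega : j ≤ n)
    have h2 : bavg g j y ≤ _ := (le_max_right _ _).trans h1.le
    rw [hMk] at h2
    have h3 : ∑ i ∈ Finset.Ico j (n + 1), incr g m K i y ≤ ∑ i ∈ Finset.range (n + 1), W i y := by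
      refine (Finset.sum_le_sum fun i hi => ?_).trans
        (Finset.sum_le_sum_of_subset_of_nonneg (t := Finset.range (n + 1)) (fun i hi => ?_)
          fun i _ _ => hW0 i y)
      · obtain ⟨hi1, hi2⟩ := Finset.mem_Ico.1 hi
        refine max_le (hW0 i y) (sub_le_excess_add g m K i y le_rfl ?_)
        have hMi : l ≤ runMax g m K i y := by
          rcases (by omega : i = n ∨ i < n) with rfl | h
          · rw [hMk]; exact hgl.le
          · have := runMax_anti g m h hn.le y
            rw [hMk] at this
            exact hgl.le.trans ((le_max_left _ _).trans this)
        have hle : bavg (fun z => if runMax g m K i y < g z then (1:ℝ) else 0) i y ≤ bavg I i y :=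
          bavg_mono fun z _ => by
            simp only [hI]
            split_ifs with h4 h5
            · exact le_rfl
            · exact absurd (hMi.trans_lt h4) h5
            · exact zero_le_one
            · exact le_rfl
        refine hle.trans ?_
        rcases hi1.eq_or_lt with rfl | hi1
        · refine (bavg_le_succ hI0 _ y).trans ?_
          rcases (by omega : j + 1 = k ∨ j + 1 < k) with h | h
          · rw [h, bavg_congr I hy]
            have := two_pow_mul_dens d
            nlinarith
          · have := hP.2 (j + 1) (by omega) h
            nlinarith
        · exact (hP.2 i hi1 (by omega)).le.trans hκ2
      · have := Finset.mem_Ico.1 hi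
        exact Finset.mem_range.2 (by omega)
    rw [Finset.sum_range_succ] at h3
    rw [hα]
    linarith
  -- the density of the exceptional set
  have hFk : bavg F k x ≤ dens d / κ := by
    rw [le_div_iff₀ hκ0]
    have : (∑ y ∈ blk k x, F y) * κ ≤ ∑ y ∈ blk k x, I y := by
      calc (∑ y ∈ blk k x, F y) * κ
          = ∑ j ∈ Finset.range k, ∑ y ∈ blk k x, (if P j y then κ else 0) := by
            rw [Finset.sum_comm, Finset.sum_mul]
            refine Finset.sum_congr rfl fun j _ => ?_
            rw [Finset.sum_mul]
            exact Finset.sum_congr rfl fun y _ => by split_ifs <;> simp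
        _ ≤ ∑ j ∈ Finset.range k, ∑ y ∈ blk k x, (if P j y then bavg I j y else 0) := by
            gcongr with j _ y _
            split_ifs with h
            · exact h.1
            · exact le_rfl
        _ = ∑ j ∈ Finset.range k, ∑ y ∈ blk k x, (if P j y then I y else 0) :=
            Finset.sum_congr rfl fun j hj => sum_ite_isTopLevel I I κ (Finset.mem_range.1 hj) x
        _ = ∑ y ∈ blk k x, ∑ j ∈ Finset.range k, (if P j y then I y else 0) := Finset.sum_comm
        _ ≤ ∑ y ∈ blk k x, I y := by
            refine Finset.sum_le_sum fun y _ => ?_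
            by_cases h : ∃ j < k, P j y
            · obtain ⟨j, hj, hP⟩ := h
              rw [hsum j y (fun _ => I y) hj hP]
            · rw [hsum0 y (fun _ => I y) h]
              exact hI0 y
    rw [sum_blk_eq, sum_blk_eq, mul_assoc] at this
    exact (le_of_mul_le_mul_left this (by positivity)).trans hIk
  have hFk' : 2 ^ d * bavg F k x ≤ 1 / 8 := by
    have h1 : 2 ^ d * (dens d / κ) = 1 / 8 := by
      rw [hκ, dens]; field_simp; norm_num
    nlinarith
  have hFk'' : bavg F k x ≤ 1 / 8 := by
    have := bavg_nonneg hF0 k x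
    nlinarith
  have hFW : bavg (fun y => F y * W n y) k x ≤ 1 / 8 * bavg (W n) k x := by
    have h1 : bavg (fun y => F y * W n y) k x =
        bavg (bavg (fun y => F y * W n y) n) k x := (bavg_bavg _ (by omega) x).symm
    have h2 : 1 / 8 * bavg (W n) k x = bavg (fun y => 1 / 8 * W n y) k x := by
      simp only [bavg, ← Finset.mul_sum]; ring
    rw [h1, h2]
    refine bavg_mono fun y hy => ?_
    have h3 : ∀ z ∈ blk n y, W n z = W n y := fun z hz => by
      simp only [hW, excess, blkVar, bavg_congr _ hz, thr_congr g m hz]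
    rw [bavg_mul_const F (W n) h3]
    have h4 := bavg_le_succ hF0 n y
    rw [← hk, bavg_congr F hy] at h4
    have := hW0 n y
    gcongr
    linarith
  -- the main estimate
  have hmain : α ≤ bavg (fun y => F y * α + ∑ i ∈ Finset.range n, W i y + F y * W n y) k x := by
    have h1 : ∑ y ∈ blk k x, (g y - l) ≤
        ∑ y ∈ blk k x, (F y * α + ∑ i ∈ Finset.range n, W i y + F y * W n y) := by
      calc ∑ y ∈ blk k x, (g y - l)
          ≤ ∑ y ∈ blk k x, ∑ j ∈ Finset.range k, (if P j y then g y - l else 0) := by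
            refine Finset.sum_le_sum fun y _ => ?_
            by_cases h : ∃ j < k, P j y
            · obtain ⟨j, hj, hP⟩ := h
              rw [hsum j y (fun _ => g y - l) hj hP]
            · rw [hsum0 y (fun _ => g y - l) h]
              by_contra! hlt
              refine h (exists_isTopLevel (by omega) ?_)
              simp only [hI]
              rw [if_pos (by linarith)]
              linarith
        _ = ∑ j ∈ Finset.range k, ∑ y ∈ blk k x, (if P j y then g y - l else 0) := Finset.sum_comm
        _ = ∑ j ∈ Finset.range k, ∑ y ∈ blk k x,
              (if P j y then bavg (fun y => g y - l) j y else 0) :=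
            Finset.sum_congr rfl fun j hj =>
              (sum_ite_isTopLevel (fun y => g y - l) I κ (Finset.mem_range.1 hj) x).symm
        _ = ∑ y ∈ blk k x, ∑ j ∈ Finset.range k,
              (if P j y then bavg (fun y => g y - l) j y else 0) := Finset.sum_comm
        _ ≤ _ := by
            refine Finset.sum_le_sum fun y hy => ?_
            have hWs : 0 ≤ ∑ i ∈ Finset.range n, W i y := Finset.sum_nonneg fun i _ => hW0 i y
            by_cases h : ∃ j < k, P j y
            · obtain ⟨j, hj, hP⟩ := h
              have hF1 : F y = 1 := hsum j y (fun _ => 1) hj hP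
              rw [hsum j y (fun j => bavg (fun y => g y - l) j y) hj hP, hF1]
              have h5 : bavg (fun y => g y - l) j y = bavg g j y - l := by
                have := bavg_add g (fun _ => - l) j y
                rw [bavg_const] at this
                exact this
              rw [h5, one_mul, one_mul]
              exact hbound y hy j hj hP
            · have hF1 : F y = 0 := hsum0 y (fun _ => 1) h
              rw [hsum0 y (fun j => bavg (fun y => g y - l) j y) h, hF1]
              linarith
    rw [sum_blk_eq, sum_blk_eq] at h1
    have h2 := le_of_mul_le_mul_left h1 (by positivity)
    have h3 := bavg_add g (fun _ => - l) k x
    rw [bavg_const] at h3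
    have h4 : bavg (fun y => g y - l) k x = bavg g k x - l := h3
    rw [h4, ← hα] at h2
    exact h2
  rw [bavg_add, bavg_add, bavg_sum, bavg_mul_const F (fun _ => α) fun _ _ => rfl] at hmain
  rw [Finset.sum_range_succ]
  have : bavg F k x * α ≤ 1 / 8 * α := by gcongr
  linarith

lemma excess_zero {d : ℕ} (g : (Fin d → ℤ) → ℝ) (m : ℝ) (K : ℕ) (x : Fin d → ℤ) :
    excess g m K 0 x = 0 := by
  refine max_eq_left ?_
  have h := bavg_thr_le g m K 0 x
  rw [bavg_zero] at h ⊢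
  have := dens_le d
  by_contra! hlt
  rw [if_pos (by linarith)] at h
  linarith

/-- The variation bound on the lattice. -/
theorem lattice_bound {d : ℕ} (g : (Fin d → ℤ) → ℝ) (m : ℝ) (K : ℕ) (x₀ : Fin d → ℤ)
    (β : ℕ → (Fin d → ℤ) → ℝ)
    (hβ : ∀ k ≤ K, ∀ x ∈ blk K x₀, β k x ≤ 0 ∨ ∃ l, runMax g m K k x ≤ l ∧
      bavg (fun y => if l < g y then 1 else 0) k x ≤ 1 / 2 ∧ β k x ≤ bavg g k x - l) :
    ∑ k ∈ Finset.range (K + 1), ∑ x ∈ blk K x₀, β k x / 2 ^ k ≤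
      6 / dens d * ∑ y ∈ blk K x₀, edgeVar K g y := by
  let A : ℕ → ℝ := fun k => ∑ x ∈ blk K x₀, excess g m K k x
  let V : ℕ → ℝ := fun k => ∑ x ∈ blk K x₀, blkVar g m K k x
  have hsub : ∀ k ≤ K, ∀ y ∈ blk K x₀, blk k y ⊆ blk K x₀ := fun k hk y hy =>
    blk_subset_blk hk hy
  have hA : ∀ k, 0 ≤ A k := fun k => Finset.sum_nonneg fun x _ => excess_nonneg _ _ _ _ _
  have hV : ∀ k, 0 ≤ V k := fun k => Finset.sum_nonneg fun x _ => blkVar_nonneg _ _ _ _ _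
  have h1 := sum_geometric_absorb A V K hA hV (by simp [A, excess_zero]) (fun n hn => by
    have h := Finset.sum_le_sum fun x (_ : x ∈ blk K x₀) => excess_le g m hn x
    rw [← Finset.mul_sum, Finset.sum_sub_distrib, ← Finset.mul_sum, Finset.sum_comm] at h
    simp only [sum_bavg _ _ _ (hsub (n + 1) hn), Finset.sum_add_distrib] at h
    simpa only [A, V, Finset.sum_add_distrib] using h)
  have hVk : ∀ k ≤ K, V k / 2 ^ k = 2 / dens d * ∑ x ∈ blk K x₀, levelVar g m K k x := by
    intro k hk
    simp only [V, blkVar, ← Finset.mul_sum]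
    rw [sum_bavg _ _ _ (hsub k hk)]
    field_simp
  have h2 : ∑ k ∈ Finset.range (K + 1), V k / 2 ^ k ≤
      2 / dens d * ∑ y ∈ blk K x₀, edgeVar K g y := by
    rw [Finset.sum_congr rfl fun k hk => hVk k (by simpa [Nat.lt_succ_iff] using hk),
      ← Finset.mul_sum, Finset.sum_comm]
    have := dens_pos d
    gcongr with y _
    exact sum_levelVar_le g m K y
  have h3 : ∑ k ∈ Finset.range (K + 1), ∑ x ∈ blk K x₀, β k x / 2 ^ k ≤
      ∑ k ∈ Finset.range (K + 1), (A k / 2 ^ k + V k / 2 ^ k) := by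
    refine Finset.sum_le_sum fun k hk => ?_
    rw [← add_div, ← Finset.sum_div, ← Finset.sum_add_distrib]
    gcongr with x hx
    rcases hβ k (by simpa [Nat.lt_succ_iff] using hk) x hx with h | ⟨l, h4, h5, h6⟩
    · exact h.trans (add_nonneg (excess_nonneg _ _ _ _ _) (blkVar_nonneg _ _ _ _ _))
    · exact h6.trans (sub_le_excess_add g m K k x h4 h5)
  rw [Finset.sum_add_distrib] at h3
  have h4 : 6 / dens d * ∑ y ∈ blk K x₀, edgeVar K g y =
      3 * (2 / dens d * ∑ y ∈ blk K x₀, edgeVar K g y) := by ring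
  rw [h4]
  linarith

/-- The half-open cell of side `h` with index `p`. -/
def cell {d : ℕ} (h : ℝ) (p : Fin d → ℤ) : Set (Ed d) :=
  {x | ∀ i, x i ∈ Set.Ico (h * p i) (h * (p i + 1))}

/-- The open cell of side `h` with index `p`. -/
def openCell {d : ℕ} (h : ℝ) (p : Fin d → ℤ) : Set (Ed d) :=
  {x | ∀ i, x i ∈ Set.Ioo (h * p i) (h * (p i + 1))}

/-- The open box consisting of two neighboring cells and their common face. -/
def openBox {d : ℕ} (h : ℝ) (i : Fin d) (p : Fin d → ℤ) : Set (Ed d) :=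
  {x | x i ∈ Set.Ioo (h * p i) (h * (p i + 2)) ∧
    ∀ j, j ≠ i → x j ∈ Set.Ioo (h * p j) (h * (p j + 1))}

/-- A smooth approximation of the indicator function of `(0, h)` from inside. -/
structure IsCutoff (β : ℝ → ℝ) (h δ : ℝ) : Prop where
  pos : 0 < δ
  contDiff : ContDiff ℝ 1 β
  nonneg : ∀ r, 0 ≤ β r
  le_one : ∀ r, β r ≤ 1
  left : ∀ r, r ≤ δ → β r = 0
  right : ∀ r, h - δ ≤ r → β r = 0

/-- The mass of `β` in the window of length `h` that ends in `s`. -/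
def window (β : ℝ → ℝ) (h s : ℝ) : ℝ := ∫ r in (s - h)..s, β r

lemma IsCutoff.hasDerivAt_window {β : ℝ → ℝ} {h δ : ℝ} (hβ : IsCutoff β h δ) (s : ℝ) :
    HasDerivAt (window β h) (β s - β (s - h)) s := by
  have hc := hβ.contDiff.continuous
  have h1 : ∀ s, HasDerivAt (fun s => ∫ r in (0:ℝ)..s, β r) (β s) s := fun s =>
    (hc.integral_hasStrictDerivAt 0 s).hasDerivAt
  have h2 : window β h = fun s => (∫ r in (0:ℝ)..s, β r) - ∫ r in (0:ℝ)..(s - h), β r := by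
    ext s
    rw [window, intervalIntegral.integral_interval_sub_left] <;> exact hc.intervalIntegrable _ _
  rw [h2]
  exact (h1 s).sub ((h1 (s - h)).comp_sub_const s h)

lemma IsCutoff.contDiff_window {β : ℝ → ℝ} {h δ : ℝ} (hβ : IsCutoff β h δ) :
    ContDiff ℝ 1 (window β h) := by
  rw [contDiff_one_iff_deriv]
  refine ⟨fun s => (hβ.hasDerivAt_window s).differentiableAt, ?_⟩
  have : deriv (window β h) = fun s => β s - β (s - h) :=
    funext fun s => (hβ.hasDerivAt_window s).deriv
  rw [this]
  have hc := hβ.contDiff.continuous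
  fun_prop

lemma IsCutoff.window_bounds {β : ℝ → ℝ} {h δ : ℝ} (hβ : IsCutoff β h δ) (hh : 0 < h) (s : ℝ) :
    0 ≤ window β h s ∧ window β h s ≤ h := by
  have hc := hβ.contDiff.continuous
  constructor
  · exact intervalIntegral.integral_nonneg (by linarith) fun r _ => hβ.nonneg r
  · have := intervalIntegral.integral_mono_on (a := s - h) (b := s) (μ := volume) (by linarith)
      (hc.intervalIntegrable _ _) (continuous_const.intervalIntegrable (μ := volume) _ _)
      fun r _ => hβ.le_one r
    simpa [window] using this

lemma IsCutoff.window_eq_zero {β : ℝ → ℝ} {h δ : ℝ} (hβ : IsCutoff β h δ) (hh : 0 < h) {s : ℝ}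
    (hs : s ∉ Set.Icc δ (2 * h - δ)) : window β h s = 0 := by
  have : ∫ r in (s - h)..s, β r = ∫ r in (s - h)..s, (0:ℝ) := by
    refine intervalIntegral.integral_congr fun r hr => ?_
    rw [Set.uIcc_of_le (by linarith)] at hr
    rcases lt_or_ge s δ with h1 | h1
    · exact hβ.left r (hr.2.trans h1.le)
    · refine hβ.right r ?_
      by_contra! h2
      exact hs ⟨h1, by linarith [hr.1]⟩
  rw [window, this]
  simp

/-- The smooth approximation of the indicator function of a cell. -/
def cellBump {d : ℕ} (β : ℝ → ℝ) (h : ℝ) (p : Fin d → ℤ) (x : Ed d) : ℝ :=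
  ∏ j, β (x j - h * p j)

/-- The potential whose derivative is the difference of two cell bumps. -/
def boxBump {d : ℕ} (β : ℝ → ℝ) (h : ℝ) (i : Fin d) (p : Fin d → ℤ) (x : Ed d) : ℝ :=
  window β h (x i - h * p i) * ∏ j ∈ Finset.univ.erase i, β (x j - h * p j)

lemma IsCutoff.contDiff_boxBump {d : ℕ} {β : ℝ → ℝ} {h δ : ℝ} (hβ : IsCutoff β h δ) (i : Fin d)
    (p : Fin d → ℤ) : ContDiff ℝ 1 (boxBump β h i p) := by
  have hx : ∀ j : Fin d, ContDiff ℝ 1 fun x : Ed d => x j - h * p j := fun j =>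
    (EuclideanSpace.proj (𝕜 := ℝ) j).contDiff.sub contDiff_const
  exact (hβ.contDiff_window.comp (hx i)).mul (contDiff_prod fun j _ => hβ.contDiff.comp (hx j))

lemma IsCutoff.fderiv_boxBump {d : ℕ} {β : ℝ → ℝ} {h δ : ℝ} (hβ : IsCutoff β h δ) (i : Fin d)
    (p : Fin d → ℤ) (x : Ed d) :
    fderiv ℝ (boxBump β h i p) x (EuclideanSpace.single i 1) =
      cellBump β h p x - cellBump β h (p + Pi.single i 1) x := by
  have hd : DifferentiableAt ℝ (boxBump β h i p) x :=
    (hβ.contDiff_boxBump i p).differentiable (by norm_num) x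
  rw [← hd.lineDeriv_eq_fderiv]
  have h1 : (fun t : ℝ => boxBump β h i p (x + t • EuclideanSpace.single i 1)) = fun t =>
      window β h (t + (x i - h * p i)) * ∏ j ∈ Finset.univ.erase i, β (x j - h * p j) := by
    ext t
    unfold boxBump
    congr 1
    · congr 1; simp; ring
    · refine Finset.prod_congr rfl fun j hj => ?_
      simp [(Finset.mem_erase.1 hj).1]
  have h2 : HasDerivAt (fun t : ℝ => window β h (t + (x i - h * p i)) *
      ∏ j ∈ Finset.univ.erase i, β (x j - h * p j))
      ((β (0 + (x i - h * p i)) - β (0 + (x i - h * p i) - h)) *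
        ∏ j ∈ Finset.univ.erase i, β (x j - h * p j)) 0 :=
    ((hβ.hasDerivAt_window _).comp_add_const 0 (x i - h * p i)).mul_const _
  rw [lineDeriv, h1, h2.deriv, sub_mul]
  unfold cellBump
  rw [← Finset.mul_prod_erase _ _ (Finset.mem_univ i), ← Finset.mul_prod_erase _ _ (Finset.mem_univ i)]
  congr 1
  · simp
  · congr 1
    · congr 1; simp; ring
    · refine Finset.prod_congr rfl fun j hj => ?_
      simp [(Finset.mem_erase.1 hj).1]

/-- The closed box that carries `boxBump`. -/
def closedBox {d : ℕ} (h δ : ℝ) (i : Fin d) (p : Fin d → ℤ) : Set (Ed d) :=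
  {x | x i - h * p i ∈ Set.Icc δ (2 * h - δ) ∧
    ∀ j, j ≠ i → x j - h * p j ∈ Set.Icc δ (h - δ)}

lemma closedBox_subset {d : ℕ} {h δ : ℝ} (hδ : 0 < δ) (i : Fin d) (p : Fin d → ℤ) :
    closedBox h δ i p ⊆ openBox h i p := by
  rintro x ⟨h1, h2⟩
  refine ⟨⟨by linarith [h1.1], by linarith [h1.2]⟩, fun j hj => ?_⟩
  have := h2 j hj
  exact ⟨by linarith [this.1], by linarith [this.2]⟩

lemma isCompact_closedBox {d : ℕ} (h δ : ℝ) (i : Fin d) (p : Fin d → ℤ) :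
    IsCompact (closedBox h δ i p) := by
  have hK : IsCompact (Set.pi Set.univ fun j : Fin d =>
      Set.Icc (δ + h * p j) (if j = i then 2 * h - δ + h * p j else h - δ + h * p j)) :=
    isCompact_univ_pi fun j => isCompact_Icc
  have := (EuclideanSpace.equiv (Fin d) ℝ).toHomeomorph.isCompact_preimage.2 hK
  convert this using 1
  ext x
  simp only [closedBox, Set.mem_preimage, Set.mem_pi, Set.mem_univ, true_implies, Set.mem_ofPred_eq,
    Set.mem_Icc]
  constructor
  · rintro ⟨h1, h2⟩ j
    change δ + h * p j ≤ x j ∧ x j ≤ _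
    rcases eq_or_ne j i with rfl | hj
    · simp only [if_true]; constructor <;> linarith
    · have := h2 j hj
      simp only [hj, if_false]; constructor <;> linarith
  · intro hx
    have hx' : ∀ j, δ + h * p j ≤ x j ∧
      x j ≤ (if j = i then 2 * h - δ + h * p j else h - δ + h * p j) := hx
    refine ⟨?_, fun j hj => ?_⟩
    · have := hx' i
      simp only [if_true] at this
      constructor <;> linarith
    · have := hx' j
      simp only [hj, if_false] at this
      constructor <;> linarith

lemma IsCutoff.boxBump_eq_zero {d : ℕ} {β : ℝ → ℝ} {h δ : ℝ} (hβ : IsCutoff β h δ) (hh : 0 < h)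
    {i : Fin d} {p : Fin d → ℤ} {x : Ed d} (hx : x ∉ closedBox h δ i p) :
    boxBump β h i p x = 0 := by
  by_cases h1 : x i - h * p i ∈ Set.Icc δ (2 * h - δ)
  · have : ∃ j, j ≠ i ∧ x j - h * p j ∉ Set.Icc δ (h - δ) := by
      by_contra! h2
      exact hx ⟨h1, h2⟩
    obtain ⟨j, hj, h2⟩ := this
    refine mul_eq_zero_of_right _ (Finset.prod_eq_zero (i := j) (by simp [hj]) ?_)
    rcases lt_or_ge (x j - h * p j) δ with h3 | h3
    · exact hβ.left _ h3.le
    · refine hβ.right _ ?_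
      by_contra! h4
      exact h2 ⟨h3, h4.le⟩
  · exact mul_eq_zero_of_left (hβ.window_eq_zero hh h1) _

lemma IsCutoff.abs_boxBump_le {d : ℕ} {β : ℝ → ℝ} {h δ : ℝ} (hβ : IsCutoff β h δ) (hh : 0 < h)
    (i : Fin d) (p : Fin d → ℤ) (x : Ed d) : |boxBump β h i p x| ≤ h := by
  have h1 := hβ.window_bounds hh (x i - h * p i)
  have h2 : 0 ≤ ∏ j ∈ Finset.univ.erase i, β (x j - h * p j) :=
    Finset.prod_nonneg fun _ _ => hβ.nonneg _
  have h3 : ∏ j ∈ Finset.univ.erase i, β (x j - h * p j) ≤ 1 :=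
    Finset.prod_le_one (fun _ _ => hβ.nonneg _) fun _ _ => hβ.le_one _
  rw [boxBump, abs_mul, abs_of_nonneg h1.1, abs_of_nonneg h2]
  nlinarith

lemma IsCutoff.cellBump_bounds {d : ℕ} {β : ℝ → ℝ} {h δ : ℝ} (hβ : IsCutoff β h δ)
    (p : Fin d → ℤ) (x : Ed d) : 0 ≤ cellBump β h p x ∧ cellBump β h p x ≤ 1 :=
  ⟨Finset.prod_nonneg fun _ _ => hβ.nonneg _,
    Finset.prod_le_one (fun _ _ => hβ.nonneg _) fun _ _ => hβ.le_one _⟩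

lemma IsCutoff.continuous_cellBump {d : ℕ} {β : ℝ → ℝ} {h δ : ℝ} (hβ : IsCutoff β h δ)
    (p : Fin d → ℤ) : Continuous (cellBump β h p) := by
  have hc := hβ.contDiff.continuous
  unfold cellBump
  fun_prop

lemma IsCutoff.integrableOn_mul {d : ℕ} {β : ℝ → ℝ} {h δ : ℝ} (hβ : IsCutoff β h δ)
    (p : Fin d → ℤ) {U : Set (Ed d)} {f : Ed d → ℝ} (hf : IntegrableOn f U) :
    IntegrableOn (fun x => f x * cellBump β h p x) U := by
  refine Integrable.mul_bdd (c := 1) hf (hβ.continuous_cellBump p).aestronglyMeasurable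
    (ae_of_all _ fun x => ?_)
  rw [Real.norm_eq_abs, abs_of_nonneg (hβ.cellBump_bounds p x).1]
  exact (hβ.cellBump_bounds p x).2

/-- The variation tested with a combination of box bumps. -/
lemma IsCutoff.le_var {d : ℕ} {β : ℝ → ℝ} {h δ : ℝ} (hβ : IsCutoff β h δ) (hh : 0 < h)
    {U : Set (Ed d)} {f : Ed d → ℝ} (hf : IntegrableOn f U) (i : Fin d)
    (E : Finset (Fin d → ℤ)) (hE : ∀ p ∈ E, openBox h i p ⊆ U)
    (hdisj : ∀ p ∈ E, ∀ q ∈ E, ∀ x, x ∈ openBox h i p → x ∈ openBox h i q → p = q)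
    (s : (Fin d → ℤ) → ℝ) (hs : ∀ p, |s p| ≤ 1) :
    ENNReal.ofReal (∑ p ∈ E, h⁻¹ * (s p * ((∫ x in U, f x * cellBump β h p x) -
      ∫ x in U, f x * cellBump β h (p + Pi.single i 1) x))) ≤ var U f := by
  let ψ : Ed d → ℝ := fun x => ∑ p ∈ E, h⁻¹ * (s p * boxBump β h i p x)
  have hψ1 : ContDiff ℝ 1 ψ := ContDiff.sum fun p _ =>
    contDiff_const.mul (contDiff_const.mul (hβ.contDiff_boxBump i p))
  have hψd : ∀ x, fderiv ℝ ψ x (EuclideanSpace.single i 1) = ∑ p ∈ E, h⁻¹ * (s p *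
      (cellBump β h p x - cellBump β h (p + Pi.single i 1) x)) := by
    intro x
    have hd : ∀ p, DifferentiableAt ℝ (boxBump β h i p) x := fun p =>
      (hβ.contDiff_boxBump i p).differentiable (by norm_num) x
    have : HasFDerivAt ψ (∑ p ∈ E, h⁻¹ • (s p • fderiv ℝ (boxBump β h i p) x)) x :=
      HasFDerivAt.fun_sum fun p _ => ((hd p).hasFDerivAt.const_mul (s p)).const_mul h⁻¹
    rw [this.fderiv]
    simp [hβ.fderiv_boxBump]
  let φ : Ed d → Ed d := fun x => ψ x • EuclideanSpace.single i (1:ℝ)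
  have hdiv : ∀ x, divergence φ x = fderiv ℝ ψ x (EuclideanSpace.single i 1) := by
    intro x
    have hd : DifferentiableAt ℝ ψ x := hψ1.differentiable (by norm_num) x
    have : fderiv ℝ φ x = (fderiv ℝ ψ x).smulRight (EuclideanSpace.single i (1:ℝ)) :=
      (hd.hasFDerivAt.smul_const _).fderiv
    rw [divergence, this, Finset.sum_eq_single i]
    · simp
    · intro j _ hj
      simp [hj]
    · simp
  let K : Set (Ed d) := ⋃ p ∈ E, closedBox h δ i p
  have hK : IsCompact K := E.isCompact_biUnion fun p _ => isCompact_closedBox h δ i p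
  have hKU : K ⊆ U := Set.iUnion₂_subset fun p hp =>
    (closedBox_subset hβ.pos i p).trans (hE p hp)
  have hφK : ∀ x, x ∉ K → φ x = 0 := by
    intro x hx
    have : ψ x = 0 := Finset.sum_eq_zero fun p hp => by
      rw [hβ.boxBump_eq_zero hh fun h => hx (Set.mem_biUnion hp h)]
      simp
    simp [φ, this]
  have hmem : φ ∈ {φ : Ed d → Ed d | ContDiff ℝ 1 φ ∧ HasCompactSupport φ ∧ tsupport φ ⊆ U ∧
      ∀ x, ‖φ x‖ ≤ 1} := by
    refine ⟨hψ1.smul contDiff_const, HasCompactSupport.intro hK hφK, ?_, fun x => ?_⟩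
    · refine (closure_minimal (fun x hx => ?_) hK.isClosed).trans hKU
      by_contra h
      exact hx (hφK x h)
    · simp only [φ, norm_smul, PiLp.norm_single, norm_one, mul_one, Real.norm_eq_abs]
      by_cases hx : ∃ p ∈ E, x ∈ openBox h i p
      · obtain ⟨p, hp, hx⟩ := hx
        have : ψ x = h⁻¹ * (s p * boxBump β h i p x) := by
          refine Finset.sum_eq_single_of_mem p hp fun q hq hne => ?_
          rw [hβ.boxBump_eq_zero hh fun h' => hne
            (hdisj q hq p hp x (closedBox_subset hβ.pos i q h') hx)]
          simp
        rw [this, abs_mul, abs_mul, abs_of_pos (inv_pos.2 hh), inv_mul_le_iff₀ hh]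
        have h1 := hs p
        have h2 := hβ.abs_boxBump_le hh i p x
        have := abs_nonneg (s p)
        have := abs_nonneg (boxBump β h i p x)
        nlinarith
      · have : φ x = 0 := hφK x fun h => hx <| by
          obtain ⟨p, hp, h⟩ := Set.mem_iUnion₂.1 h
          exact ⟨p, hp, closedBox_subset hβ.pos i p h⟩
        have h0 : ψ x = 0 := by
          have := congrArg (fun v : Ed d => v i) this
          simpa [φ] using this
        simp [h0]
  have hint : ∫ x in U, f x * divergence φ x = ∑ p ∈ E, h⁻¹ * (s p *
      ((∫ x in U, f x * cellBump β h p x) -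
        ∫ x in U, f x * cellBump β h (p + Pi.single i 1) x)) := by
    have h1 : ∀ x, f x * divergence φ x = ∑ p ∈ E, h⁻¹ * (s p *
        (f x * cellBump β h p x - f x * cellBump β h (p + Pi.single i 1) x)) := by
      intro x
      rw [hdiv, hψd, Finset.mul_sum]
      exact Finset.sum_congr rfl fun p _ => by ring
    have hI := fun p => hβ.integrableOn_mul p hf
    simp only [h1]
    rw [integral_finsetSum]
    · refine Finset.sum_congr rfl fun p _ => ?_
      rw [integral_const_mul, integral_const_mul, integral_sub (hI p) (hI _)]
    · exact fun p _ => (((hI p).sub (hI _)).const_mul _).const_mul _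
  rw [← hint]
  exact le_iSup₂_of_le φ hmem le_rfl

lemma exists_cutoff_seq {h : ℝ} (hh : 0 < h) : ∃ (β : ℕ → ℝ → ℝ) (δ : ℕ → ℝ),
    (∀ n, IsCutoff (β n) h (δ n)) ∧
      ∀ r ∈ Set.Ioo 0 h, Tendsto (fun n => β n r) atTop (𝓝 1) := by
  have hq : ∀ n : ℕ, (0:ℝ) < 1 / ((n:ℝ) + 2) ∧ 1 / ((n:ℝ) + 3) < 1 / ((n:ℝ) + 2) ∧
      1 / ((n:ℝ) + 2) < 1 ∧ (0:ℝ) < 1 / ((n:ℝ) + 3) := fun n => by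
    have hn : (0:ℝ) ≤ n := Nat.cast_nonneg n
    refine ⟨by positivity, one_div_lt_one_div_of_lt (by linarith) (by linarith), ?_, by positivity⟩
    rw [div_lt_one (by positivity)]
    linarith
  let B : ℕ → ContDiffBump (h / 2) := fun n =>
    { rIn := h / 2 * (1 - 1 / ((n:ℝ) + 2))
      rOut := h / 2 * (1 - 1 / ((n:ℝ) + 3))
      rIn_pos := by have := hq n; have : 0 < 1 - 1 / ((n:ℝ) + 2) := by linarith
                    positivity
      rIn_lt_rOut := mul_lt_mul_of_pos_left (by linarith [hq n]) (by linarith) }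
  refine ⟨fun n => B n, fun n => h / 2 * (1 / ((n:ℝ) + 3)), fun n => ?_, fun r hr => ?_⟩
  · have hp : 0 < h / 2 * (1 / ((n:ℝ) + 3)) := mul_pos (by linarith) (hq n).2.2.2
    have hout : (B n).rOut = h / 2 - h / 2 * (1 / ((n:ℝ) + 3)) := by
      change h / 2 * (1 - 1 / ((n:ℝ) + 3)) = _
      ring
    refine ⟨hp, (B n).contDiff, fun r => (B n).nonneg, fun r => (B n).le_one, fun r hr => ?_,
      fun r hr => ?_⟩
    · refine (B n).zero_of_le_dist ?_
      rw [hout, Real.dist_eq, abs_sub_comm]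
      exact le_trans (by linarith) (le_abs_self _)
    · refine (B n).zero_of_le_dist ?_
      rw [hout, Real.dist_eq]
      exact le_trans (by linarith) (le_abs_self _)
  · have hlim : Tendsto (fun n : ℕ => h / 2 * (1 - 1 / ((n:ℝ) + 2))) atTop (𝓝 (h / 2 * (1 - 0))) := by
      refine (tendsto_const_nhds.sub ?_).const_mul _
      have := (tendsto_const_div_atTop_nhds_zero_nat (1:ℝ)).comp (tendsto_add_atTop_nat 2)
      refine this.congr fun n => ?_
      simp
    have hlt : |r - h / 2| < h / 2 * (1 - 0) := by
      rw [abs_lt]; constructor <;> linarith [hr.1, hr.2]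
    refine tendsto_const_nhds.congr' ?_
    filter_upwards [hlim.eventually (lt_mem_nhds hlt)] with n hn
    refine ((B n).one_of_mem_closedBall ?_).symm
    rw [mem_closedBall, Real.dist_eq]
    exact hn.le

lemma cell_eq_preimage {d : ℕ} (h : ℝ) (p : Fin d → ℤ) :
    cell h p = (MeasurableEquiv.toLp 2 (Fin d → ℝ)).symm ⁻¹'
      Set.pi Set.univ fun i => Set.Ico (h * p i) (h * (p i + 1)) := by
  ext x
  simp only [cell, Set.mem_preimage, Set.mem_pi, Set.mem_univ, true_implies, Set.mem_ofPred_eq]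
  rfl

lemma openCell_eq_preimage {d : ℕ} (h : ℝ) (p : Fin d → ℤ) :
    openCell h p = (MeasurableEquiv.toLp 2 (Fin d → ℝ)).symm ⁻¹'
      Set.pi Set.univ fun i => Set.Ioo (h * p i) (h * (p i + 1)) := by
  ext x
  simp only [openCell, Set.mem_preimage, Set.mem_pi, Set.mem_univ, true_implies,
    Set.mem_ofPred_eq]
  rfl

lemma openCell_ae_eq_cell {d : ℕ} (h : ℝ) (p : Fin d → ℤ) :
    openCell h p =ᵐ[volume] cell h p := by
  rw [cell_eq_preimage, openCell_eq_preimage]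
  refine (EuclideanSpace.volume_preserving_symm_measurableEquiv_toLp
    (Fin d)).quasiMeasurePreserving.preimage_ae_eq ?_
  exact Measure.univ_pi_Ioo_ae_eq_Icc.trans Measure.univ_pi_Ico_ae_eq_Icc.symm

lemma measurableSet_cell {d : ℕ} (h : ℝ) (p : Fin d → ℤ) : MeasurableSet (cell h p) := by
  rw [cell_eq_preimage]
  exact (MeasurableEquiv.measurable _) (MeasurableSet.univ_pi fun i => measurableSet_Ico)

lemma measurableSet_openCell {d : ℕ} (h : ℝ) (p : Fin d → ℤ) : MeasurableSet (openCell h p) := by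
  rw [openCell_eq_preimage]
  exact (MeasurableEquiv.measurable _) (MeasurableSet.univ_pi fun i => measurableSet_Ioo)

lemma volume_cell {d : ℕ} {h : ℝ} (hh : 0 ≤ h) (p : Fin d → ℤ) :
    volume (cell h p) = ENNReal.ofReal (h ^ d) := by
  rw [cell_eq_preimage, (EuclideanSpace.volume_preserving_symm_measurableEquiv_toLp
    (Fin d)).measure_preimage
    (MeasurableSet.univ_pi fun i => measurableSet_Ico).nullMeasurableSet, Real.volume_pi_Ico]
  rw [Finset.prod_congr rfl fun i _ => by rw [show h * (p i + 1) - h * p i = h by ring]]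
  simp [ENNReal.ofReal_pow hh]

lemma openCell_subset_openBox {d : ℕ} {h : ℝ} (hh : 0 < h) (i : Fin d) (p : Fin d → ℤ) :
    openCell h p ⊆ openBox h i p ∧ openCell h (p + Pi.single i 1) ⊆ openBox h i p := by
  constructor
  · intro x hx
    refine ⟨⟨(hx i).1, (hx i).2.trans (by nlinarith)⟩, fun j _ => hx j⟩
  · intro x hx
    refine ⟨?_, fun j hj => ?_⟩
    · have := hx i
      simp only [Pi.add_apply, Pi.single_eq_same, Int.cast_add, Int.cast_one] at this
      exact ⟨by nlinarith [this.1], by nlinarith [this.2]⟩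
    · have := hx j
      simpa [hj] using this

lemma tendsto_integral_cellBump {d : ℕ} {h : ℝ} {β : ℕ → ℝ → ℝ} {δ : ℕ → ℝ}
    (hβ : ∀ n, IsCutoff (β n) h (δ n))
    (hlim : ∀ r ∈ Set.Ioo 0 h, Tendsto (fun n => β n r) atTop (𝓝 1))
    {U : Set (Ed d)} {f : Ed d → ℝ} (hf : IntegrableOn f U) {p : Fin d → ℤ}
    (hp : openCell h p ⊆ U) :
    Tendsto (fun n => ∫ x in U, f x * cellBump (β n) h p x) atTop
      (𝓝 (∫ x in cell h p, f x)) := by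
  have hI : ∫ x in cell h p, f x = ∫ x in U, (openCell h p).indicator f x := by
    rw [setIntegral_indicator (measurableSet_openCell h p), Set.inter_eq_right.2 hp]
    exact setIntegral_congr_set (openCell_ae_eq_cell h p).symm
  rw [hI]
  refine tendsto_integral_of_dominated_convergence (fun x => ‖f x‖)
    (fun n => ((hβ n).integrableOn_mul p hf).aestronglyMeasurable) hf.norm
    (fun n => ae_of_all _ fun x => ?_) (ae_of_all _ fun x => ?_)
  · rw [norm_mul, Real.norm_eq_abs (cellBump _ _ _ _), abs_of_nonneg ((hβ n).cellBump_bounds p x).1]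
    have := (hβ n).cellBump_bounds p x
    have := norm_nonneg (f x)
    nlinarith
  · by_cases hx : x ∈ openCell h p
    · rw [Set.indicator_of_mem hx]
      have : Tendsto (fun n => cellBump (β n) h p x) atTop (𝓝 (∏ _j : Fin d, 1)) :=
        tendsto_finsetProd _ fun j _ => hlim _ ⟨by linarith [(hx j).1], by linarith [(hx j).2]⟩
      simpa using this.const_mul (f x)
    · rw [Set.indicator_of_notMem hx]
      refine tendsto_const_nhds.congr fun n => ?_
      have : ∃ j, x j ∉ Set.Ioo (h * p j) (h * (p j + 1)) := by
        by_contra! h'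
        exact hx h'
      obtain ⟨j, hj⟩ := this
      have h0 : β n (x j - h * p j) = 0 := by
        have hδ := (hβ n).pos
        rcases le_or_gt (x j) (h * p j) with h1 | h1
        · exact (hβ n).left _ (by linarith)
        · refine (hβ n).right _ ?_
          by_contra! h2
          exact hj ⟨h1, by linarith⟩
      rw [cellBump, Finset.prod_eq_zero (Finset.mem_univ j) h0, mul_zero]

lemma sum_edges_le_var_of_disjoint {d : ℕ} {h : ℝ} (hh : 0 < h)
    {U : Set (Ed d)} {f : Ed d → ℝ} (hf : IntegrableOn f U) (i : Fin d)
    (E : Finset (Fin d → ℤ)) (hE : ∀ p ∈ E, openBox h i p ⊆ U)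
    (hdisj : ∀ p ∈ E, ∀ q ∈ E, ∀ x, x ∈ openBox h i p → x ∈ openBox h i q → p = q) :
    ∑ p ∈ E, ENNReal.ofReal (h⁻¹ * |(∫ x in cell h p, f x) -
      ∫ x in cell h (p + Pi.single i 1), f x|) ≤ var U f := by
  obtain ⟨β, δ, hβ, hlim⟩ := exists_cutoff_seq hh
  let s : (Fin d → ℤ) → ℝ := fun p => SignType.sign ((∫ x in cell h p, f x) -
      ∫ x in cell h (p + Pi.single i 1), f x)
  have hs : ∀ p, |s p| ≤ 1 := by
    intro p
    simp only [s]
    rcases SignType.sign ((∫ x in cell h p, f x) - ∫ x in cell h (p + Pi.single i 1), f x) <;> simp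
  have hle := fun n => (hβ n).le_var hh hf i E hE hdisj s hs
  rw [← ENNReal.ofReal_sum_of_nonneg fun p _ => by positivity]
  have hT : Tendsto (fun n => ∑ p ∈ E, h⁻¹ * (s p *
      ((∫ x in U, f x * cellBump (β n) h p x) -
        ∫ x in U, f x * cellBump (β n) h (p + Pi.single i 1) x))) atTop
      (𝓝 (∑ p ∈ E, h⁻¹ * |(∫ x in cell h p, f x) -
        ∫ x in cell h (p + Pi.single i 1), f x|)) := by
    refine tendsto_finsetSum E fun p hp => ?_
    have h1 := openCell_subset_openBox hh i p
    have h2 := ((tendsto_integral_cellBump hβ hlim hf (h1.1.trans (hE p hp))).sub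
      (tendsto_integral_cellBump hβ hlim hf (h1.2.trans (hE p hp)))).const_mul (s p)
    have h3 := h2.const_mul h⁻¹
    rwa [show s p * ((∫ x in cell h p, f x) - ∫ x in cell h (p + Pi.single i 1), f x) =
      |(∫ x in cell h p, f x) - ∫ x in cell h (p + Pi.single i 1), f x| from
      sign_mul_self _] at h3
  exact le_of_tendsto (ENNReal.tendsto_ofReal hT) (Eventually.of_forall hle)

lemma openBox_disjoint {d : ℕ} {h : ℝ} (hh : 0 < h) {i : Fin d} {p q : Fin d → ℤ} {x : Ed d}
    (hp : x ∈ openBox h i p) (hq : x ∈ openBox h i q) (hpq : p i % 2 = q i % 2) : p = q := by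
  ext j
  rcases eq_or_ne j i with rfl | hj
  · have h1 : h * p j < h * (q j + 2) := hp.1.1.trans hq.1.2
    have h2 : h * q j < h * (p j + 2) := hq.1.1.trans hp.1.2
    have h3 : (p j : ℝ) < q j + 2 := lt_of_mul_lt_mul_left h1 hh.le
    have h4 : (q j : ℝ) < p j + 2 := lt_of_mul_lt_mul_left h2 hh.le
    have h5 : p j < q j + 2 := by exact_mod_cast h3
    have h6 : q j < p j + 2 := by exact_mod_cast h4
    omega
  · have h1 : h * p j < h * (q j + 1) := (hp.2 j hj).1.trans (hq.2 j hj).2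
    have h2 : h * q j < h * (p j + 1) := (hq.2 j hj).1.trans (hp.2 j hj).2
    have h3 : (p j : ℝ) < q j + 1 := lt_of_mul_lt_mul_left h1 hh.le
    have h4 : (q j : ℝ) < p j + 1 := lt_of_mul_lt_mul_left h2 hh.le
    have h5 : p j < q j + 1 := by exact_mod_cast h3
    have h6 : q j < p j + 1 := by exact_mod_cast h4
    omega

/-- The variation dominates the sum of the jumps of the cell averages. -/
theorem sum_edges_le_var {d : ℕ} {h : ℝ} (hh : 0 < h)
    {U : Set (Ed d)} {f : Ed d → ℝ} (hf : IntegrableOn f U) (i : Fin d)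
    (E : Finset (Fin d → ℤ)) (hE : ∀ p ∈ E, openBox h i p ⊆ U) :
    ∑ p ∈ E, ENNReal.ofReal (h⁻¹ * |(∫ x in cell h p, f x) -
      ∫ x in cell h (p + Pi.single i 1), f x|) ≤ 2 * var U f := by
  rw [← Finset.sum_filter_add_sum_filter_not E fun p => p i % 2 = 0, two_mul]
  refine add_le_add ?_ ?_
  · refine sum_edges_le_var_of_disjoint hh hf i _ (fun p hp => hE p (Finset.mem_filter.1 hp).1) ?_
    intro p hp q hq x h1 h2
    have := (Finset.mem_filter.1 hp).2
    have := (Finset.mem_filter.1 hq).2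
    exact openBox_disjoint hh h1 h2 (by omega)
  · refine sum_edges_le_var_of_disjoint hh hf i _ (fun p hp => hE p (Finset.mem_filter.1 hp).1) ?_
    intro p hp q hq x h1 h2
    have := (Finset.mem_filter.1 hp).2
    have := (Finset.mem_filter.1 hq).2
    exact openBox_disjoint hh h1 h2 (by omega)

/-- The index of the half-open cell of side `η` that contains `z`. -/
def idx {d : ℕ} (η : ℝ) (z : Ed d) : Fin d → ℤ := fun i => ⌊z i / η⌋

lemma mem_cell_iff {d : ℕ} {η : ℝ} (hη : 0 < η) {z : Ed d} {p : Fin d → ℤ} :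
    z ∈ cell η p ↔ idx η z = p := by
  simp only [cell, idx, funext_iff, Set.mem_ofPred_eq, Set.mem_Ico, Int.floor_eq_iff,
    le_div_iff₀ hη, div_lt_iff₀ hη, mul_comm η]

lemma idx_mul_two_pow {d : ℕ} {η : ℝ} (k : ℕ) (z : Ed d) (i : Fin d) :
    idx (η * 2 ^ k) z i = idx η z i / 2 ^ k := by
  have := Int.floor_div_natCast (z i / η) (2 ^ k)
  simp only [idx, ← div_div]
  push_cast at this
  exact this

lemma cell_mul_two_pow {d : ℕ} {η : ℝ} (hη : 0 < η) (k : ℕ) (x : Fin d → ℤ) :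
    cell (η * 2 ^ k) (fun i => x i / 2 ^ k) = ⋃ y ∈ blk k x, cell η y := by
  ext z
  simp only [Set.mem_iUnion, exists_prop]
  rw [mem_cell_iff (by positivity)]
  simp only [mem_cell_iff hη, exists_eq_right', mem_blk]
  simp only [funext_iff, idx_mul_two_pow]

lemma pairwiseDisjoint_cell {d : ℕ} {η : ℝ} (hη : 0 < η) (s : Set (Fin d → ℤ)) :
    s.PairwiseDisjoint (cell η : (Fin d → ℤ) → Set (Ed d)) := by
  intro p _ q _ hpq
  refine Set.disjoint_left.2 fun z hp hq => hpq ?_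
  rw [← (mem_cell_iff hη).1 hp, (mem_cell_iff hη).1 hq]

/-- The average of `F` over the cell of side `η` with index `p`. -/
def cellAvg {d : ℕ} (F : Ed d → ℝ) (η : ℝ) (p : Fin d → ℤ) : ℝ := ⨍ z in cell η p, F z

lemma cellAvg_eq {d : ℕ} (F : Ed d → ℝ) {η : ℝ} (hη : 0 < η) (p : Fin d → ℤ) :
    cellAvg F η p = (∫ z in cell η p, F z) / η ^ d := by
  rw [cellAvg, setAverage_eq, measureReal_def, volume_cell hη.le,
    ENNReal.toReal_ofReal (by positivity), smul_eq_mul, div_eq_inv_mul]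

lemma bavg_cellAvg {d : ℕ} {F : Ed d → ℝ} (hF : Integrable F) {η : ℝ} (hη : 0 < η) (k : ℕ)
    (x : Fin d → ℤ) :
    bavg (cellAvg F η) k x = cellAvg F (η * 2 ^ k) fun i => x i / 2 ^ k := by
  rw [cellAvg_eq F (by positivity), cell_mul_two_pow hη,
    integral_biUnion_finset _ (fun y _ => measurableSet_cell η y) (pairwiseDisjoint_cell hη _)
    fun y _ => hF.integrableOn, bavg]
  simp only [cellAvg_eq F hη]
  rw [← Finset.sum_div, div_div, mul_pow, ← pow_mul, ← pow_mul, mul_comm d k]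

/-- Averages over half-open cells shrinking to a point converge almost everywhere, for functions
on the product space. -/
lemma ae_tendsto_average_pi {d : ℕ} {G : (Fin d → ℝ) → ℝ} (hG : LocallyIntegrable G) :
    ∀ᵐ x, ∀ (η : ℕ → ℝ), Tendsto η atTop (𝓝[>] 0) →
      Tendsto (fun n => ⨍ y in Set.pi Set.univ
        (fun i => Set.Ico (η n * ⌊x i / η n⌋) (η n * (⌊x i / η n⌋ + 1))), G y) atTop
        (𝓝 (G x)) := by
  filter_upwards [IsUnifLocDoublingMeasure.ae_tendsto_average (μ := volume) hG 1] with x hx η hη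
  have hpos : ∀ᶠ n in atTop, 0 < η n := hη.eventually self_mem_nhdsWithin
  have h2 : Tendsto (fun n => η n / 2) atTop (𝓝[>] 0) := by
    refine tendsto_nhdsWithin_iff.2 ⟨?_, hpos.mono fun n hn => half_pos hn⟩
    simpa using (tendsto_nhdsWithin_iff.1 hη).1.div_const 2
  have key : ∀ᶠ n in atTop, closedBall (fun i => η n * (⌊x i / η n⌋ + 1 / 2)) (η n / 2) =
      Set.pi Set.univ
        fun i => Set.Icc (η n * ⌊x i / η n⌋) (η n * (⌊x i / η n⌋ + 1)) := by
    filter_upwards [hpos] with n hn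
    rw [closedBall_pi _ (by positivity)]
    congr 1
    ext i : 1
    rw [Real.closedBall_eq_Icc]
    congr 1 <;> ring
  refine (hx (fun n i => η n * (⌊x i / η n⌋ + 1 / 2)) (fun n => η n / 2) h2 ?_).congr' ?_
  · filter_upwards [hpos, key] with n hn hk
    rw [one_mul, hk]
    intro i _
    have h1 := Int.floor_le (x i / η n)
    have h3 := Int.lt_floor_add_one (x i / η n)
    rw [le_div_iff₀ hn] at h1
    rw [div_lt_iff₀ hn] at h3
    constructor <;> nlinarith
  · filter_upwards [key] with n hk
    rw [hk]
    refine setAverage_congr ?_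
    rw [Set.pi_univ_Icc]
    exact Measure.univ_pi_Ico_ae_eq_Icc.symm

lemma ae_tendsto_cellAvg {d : ℕ} {F : Ed d → ℝ} (hF : Integrable F) :
    ∀ᵐ z, ∀ (η : ℕ → ℝ), Tendsto η atTop (𝓝[>] 0) →
      Tendsto (fun n => cellAvg F (η n) (idx (η n) z)) atTop (𝓝 (F z)) := by
  have hmp := EuclideanSpace.volume_preserving_symm_measurableEquiv_toLp (Fin d)
  have hG : Integrable (fun y : Fin d → ℝ => F (MeasurableEquiv.toLp 2 (Fin d → ℝ) y)) :=
    (hmp.symm _).integrable_comp_of_integrable hF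
  have := hmp.quasiMeasurePreserving.ae (ae_tendsto_average_pi hG.locallyIntegrable)
  filter_upwards [this] with z hz η hη
  refine ((hz η hη).congr fun n => ?_)
  rw [cellAvg, cell_eq_preimage, setAverage_eq, setAverage_eq, measureReal_def, measureReal_def,
    hmp.measure_preimage (MeasurableSet.univ_pi fun i => measurableSet_Ico).nullMeasurableSet,
    ← hmp.setIntegral_preimage_emb (MeasurableEquiv.measurableEmbedding _)]
  rfl

lemma measurable_idx {d : ℕ} (η : ℝ) : Measurable (idx η : Ed d → Fin d → ℤ) := by
  unfold idx
  refine measurable_pi_lambda _ fun i => Int.measurable_floor.comp ?_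
  fun_prop

lemma volume_inter_idx {d : ℕ} {η : ℝ} (hη : 0 < η) (k : ℕ) (x : Fin d → ℤ)
    (P : (Fin d → ℤ) → Prop) [DecidablePred P] :
    volume (cell (η * 2 ^ k) (fun i => x i / 2 ^ k) ∩ {z : Ed d | P (idx η z)}) =
      ((blk k x).filter P).card * ENNReal.ofReal (η ^ d) := by
  have : cell (η * 2 ^ k) (fun i => x i / 2 ^ k) ∩ {z : Ed d | P (idx η z)} =
      ⋃ y ∈ (blk k x).filter P, cell η y := by
    ext z
    rw [cell_mul_two_pow hη]
    simp only [Set.mem_inter_iff, Set.mem_iUnion, exists_prop, mem_cell_iff hη, exists_eq_right',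
      Finset.mem_filter, Set.mem_ofPred_eq]
  rw [this, measure_biUnion_finset (pairwiseDisjoint_cell hη _) fun y _ => measurableSet_cell η y]
  simp [volume_cell hη.le]

lemma eventually_bavg_le {d : ℕ} (hd : 1 ≤ d) {F : Ed d → ℝ} (hF : Integrable F)
    {η : ℕ → ℝ} (hη : Tendsto η atTop (𝓝[>] 0)) {H : ℝ} (hH : 0 < H) (p : Fin d → ℤ) {l l' : ℝ}
    (hl : l < l')
    (hvol : volume (cell H p ∩ {z | l < F z}) < volume (cell H p) / 2 ^ (d + 2)) :
    ∀ᶠ n in atTop, ∀ k : ℕ, H = η n * 2 ^ k → ∀ x : Fin d → ℤ, (fun i => x i / 2 ^ k) = p →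
      bavg (fun y => if l' < cellAvg F (η n) y then (1:ℝ) else 0) k x ≤ 1 / 2 := by
  have hfin : volume (cell H p) ≠ ∞ := by simp [volume_cell hH.le]
  have hpos : volume (cell H p) ≠ 0 := by
    rw [volume_cell hH.le]; simp; positivity
  have : IsFiniteMeasure (volume.restrict (cell H p)) := isFiniteMeasure_restrict.2 hfin
  have hae : ∀ᵐ z ∂volume.restrict (cell H p),
      Tendsto (fun n => cellAvg F (η n) (idx (η n) z)) atTop (𝓝 (F z)) :=
    ae_restrict_of_ae ((ae_tendsto_cellAvg hF).mono fun z hz => hz η hη)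
  have hmeas : ∀ n, Measurable fun z : Ed d => cellAvg F (η n) (idx (η n) z) := fun n =>
    (Measurable.of_discrete (f := cellAvg F (η n))).comp (measurable_idx (η n))
  have hT := tendstoInMeasure_of_tendsto_ae (fun n => (hmeas n).aestronglyMeasurable) hae
  rw [tendstoInMeasure_iff_norm] at hT
  have hsmall := (hT (l' - l) (by linarith)).eventually
    (gt_mem_nhds (show 0 < volume (cell H p) / 4 from ENNReal.div_pos hpos (by simp)))
  have hηpos : ∀ᶠ n in atTop, 0 < η n := hη.eventually self_mem_nhdsWithin
  filter_upwards [hsmall, hηpos] with n hn hpn k hk x hx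
  have hsub : cell H p ∩ {z | l' < cellAvg F (η n) (idx (η n) z)} ⊆
      (cell H p ∩ {z | l < F z}) ∪
      ({z | l' - l ≤ ‖cellAvg F (η n) (idx (η n) z) - F z‖} ∩ cell H p) := by
    rintro z ⟨hz1, hz2⟩
    by_cases h : l < F z
    · exact Or.inl ⟨hz1, h⟩
    · refine Or.inr ⟨?_, hz1⟩
      have hz2 : l' < cellAvg F (η n) (idx (η n) z) := hz2
      have h1 := le_abs_self (cellAvg F (η n) (idx (η n) z) - F z)
      change l' - l ≤ |cellAvg F (η n) (idx (η n) z) - F z|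
      linarith
  have h4 : volume (cell H p) / 2 ^ (d + 2) ≤ volume (cell H p) / 4 := by
    refine ENNReal.div_le_div_left ?_ _
    calc (4:ℝ≥0∞) = 2 ^ 2 := by norm_num
      _ ≤ 2 ^ (d + 2) := pow_le_pow_right₀ (by norm_num) (by omega)
  have hle : volume (cell H p ∩ {z | l' < cellAvg F (η n) (idx (η n) z)}) ≤
      volume (cell H p) / 4 + volume (cell H p) / 4 := by
    refine (measure_mono hsub).trans ((measure_union_le _ _).trans (add_le_add (hvol.le.trans h4) ?_))
    exact (Measure.le_restrict_apply _ _).trans hn.le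
  classical
  have hvi := volume_inter_idx hpn k x fun y => l' < cellAvg F (η n) y
  rw [hx, ← hk] at hvi
  rw [hvi, volume_cell hH.le, hk, ← ENNReal.ofReal_natCast,
    ← ENNReal.ofReal_mul (Nat.cast_nonneg _), show (4:ℝ≥0∞) = ENNReal.ofReal 4 by simp,
    ← ENNReal.ofReal_div_of_pos (by norm_num), ← ENNReal.ofReal_add (by positivity) (by positivity),
    ENNReal.ofReal_le_ofReal_iff (by positivity), card_filter_eq, mul_pow, ← pow_mul,
    ← pow_mul, mul_comm k d] at hle
  have hp1 : (0:ℝ) < η n ^ d * 2 ^ (d * k) := by positivity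
  refine le_of_mul_le_mul_left ?_ hp1
  linarith

lemma isOpen_openCell {d : ℕ} (h : ℝ) (p : Fin d → ℤ) : IsOpen (openCell h p) := by
  have : openCell h p = ⋂ i, {x : Ed d | x i ∈ Set.Ioo (h * p i) (h * (p i + 1))} := by
    ext x; simp [openCell]
  rw [this]
  refine isOpen_iInter_of_finite fun i => isOpen_Ioo.preimage ?_
  fun_prop

lemma openCell_subset_cell {d : ℕ} (h : ℝ) (p : Fin d → ℤ) : openCell h p ⊆ cell h p :=
  fun _ hx i => Set.Ioo_subset_Ico_self (hx i)

lemma openCell_subset_interior {d : ℕ} (h : ℝ) (p : Fin d → ℤ) :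
    openCell h p ⊆ interior (cell h p) :=
  interior_maximal (openCell_subset_cell h p) (isOpen_openCell h p)

lemma frontier_cell_subset {e : ℕ} (h : ℝ) (p : Fin (e + 1) → ℤ) :
    frontier (cell h p) ⊆ ⋃ b : Fin (e + 1) × Bool,
      (fun y : Fin e → ℝ => WithLp.toLp 2 (Fin.insertNth (α := fun _ => ℝ) b.1
        (h * (p b.1 + if b.2 then 1 else 0)) y)) ''
        Set.Icc (fun j => h * p (b.1.succAbove j)) (fun j => h * (p (b.1.succAbove j) + 1)) := by
  intro x hx
  have hcl : closure (cell h p) ⊆ {x : Ed (e + 1) | ∀ i, x i ∈ Set.Icc (h * p i) (h * (p i + 1))} := by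
    refine closure_minimal (fun x hx i => Set.Ico_subset_Icc_self (hx i)) ?_
    have : {x : Ed (e + 1) | ∀ i, x i ∈ Set.Icc (h * p i) (h * (p i + 1))} =
        ⋂ i, {x : Ed (e + 1) | x i ∈ Set.Icc (h * p i) (h * (p i + 1))} := by
      ext x; simp
    rw [this]
    refine isClosed_iInter fun i => isClosed_Icc.preimage ?_
    fun_prop
  have h1 := hcl hx.1
  have h2 : x ∉ openCell h p := fun h => hx.2 (openCell_subset_interior _ _ h)
  have h3 : ∃ i, x i ∉ Set.Ioo (h * p i) (h * (p i + 1)) := by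
    by_contra! h'
    exact h2 h'
  obtain ⟨i, hi⟩ := h3
  have key : ∃ b : Bool, x i = h * (p i + if b then 1 else 0) := by
    rcases (h1 i).1.eq_or_lt with h4 | h4
    · exact ⟨false, by simp [← h4]⟩
    · rcases (h1 i).2.eq_or_lt with h5 | h5
      · exact ⟨true, by simp [h5]⟩
      · exact absurd ⟨h4, h5⟩ hi
  obtain ⟨b, hb⟩ := key
  refine Set.mem_iUnion.2 ⟨(i, b), fun j => x (i.succAbove j), ?_, ?_⟩
  · exact ⟨fun j => (h1 _).1, fun j => (h1 _).2⟩
  · ext k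
    change Fin.insertNth (α := fun _ => ℝ) i _ (fun j => x (i.succAbove j)) k = x k
    refine Fin.succAboveCases i ?_ (fun j => ?_) k
    · simpa using hb.symm
    · simp

lemma lipschitzWith_toLp_insertNth {e : ℕ} (i : Fin (e + 1)) (v : ℝ) :
    LipschitzWith ((e + 1 : ℕ) ^ (1 / 2 : ℝ)) fun y : Fin e → ℝ =>
      (WithLp.toLp 2 (Fin.insertNth (α := fun _ => ℝ) i v y) : Ed (e + 1)) := by
  have h1 : LipschitzWith 1 fun y : Fin e → ℝ => Fin.insertNth (α := fun _ => ℝ) i v y := by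
    refine LipschitzWith.of_edist_le fun y z => ?_
    rw [edist_pi_le_iff]
    intro k
    refine Fin.succAboveCases i ?_ (fun j => ?_) k
    · simp
    · simpa using edist_le_pi_edist y z j
  have h2 := PiLp.lipschitzWith_toLp 2 (fun _ : Fin (e + 1) => ℝ)
  have := h2.comp h1
  simpa [Function.comp_def] using this

lemma exists_hausdorffMeasure_frontier_le (d : ℕ) (hd : 1 ≤ d) : ∃ C : ℝ≥0∞, C ≠ ∞ ∧
    ∀ (h : ℝ), 0 < h → ∀ p : Fin d → ℤ,
      μH[(d:ℝ) - 1] (frontier (cell h p)) ≤ C * ENNReal.ofReal (h ^ (d - 1)) := by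
  obtain ⟨e, rfl⟩ := Nat.exists_eq_add_of_le' hd
  refine ⟨Fintype.card (Fin (e + 1) × Bool) *
    (((e + 1 : ℕ) ^ (1 / 2 : ℝ) : NNReal) : ℝ≥0∞) ^ (e : ℝ), ?_, fun h hh p => ?_⟩
  · refine ENNReal.mul_ne_top (ENNReal.natCast_ne_top _) ?_
    exact ENNReal.rpow_ne_top_of_nonneg (by positivity) ENNReal.coe_ne_top
  have hc : ((e + 1 : ℕ) : ℝ) - 1 = e := by push_cast; ring
  rw [hc]
  refine (measure_mono (frontier_cell_subset h p)).trans ((measure_iUnion_fintype_le _ _).trans ?_)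
  refine (Finset.sum_le_sum fun b _ =>
    (lipschitzWith_toLp_insertNth b.1 _).hausdorffMeasure_image_le (Nat.cast_nonneg e) _).trans ?_
  have hv : ∀ b : Fin (e + 1) × Bool, μH[(e:ℝ)] (Set.Icc
      (fun j : Fin e => h * p (b.1.succAbove j)) (fun j => h * (p (b.1.succAbove j) + 1))) =
      ENNReal.ofReal (h ^ e) := by
    intro b
    have := hausdorffMeasure_pi_real (ι := Fin e)
    rw [Fintype.card_fin] at this
    rw [this, Real.volume_Icc_pi]
    rw [Finset.prod_congr rfl fun i _ => by
      rw [show h * (p (b.1.succAbove i) + 1) - h * p (b.1.succAbove i) = h by ring]]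
    simp [ENNReal.ofReal_pow hh.le]
  simp only [hv, Finset.sum_const, Finset.card_univ, nsmul_eq_mul, Nat.add_sub_cancel]
  rw [mul_assoc]

/-- The cube of side `η * 2 ^ k` that contains the cell of side `η` with index `x`. -/
def cube {d : ℕ} (η : ℝ) (k : ℕ) (x : Fin d → ℤ) : Set (Ed d) :=
  cell (η * 2 ^ k) fun i => x i / 2 ^ k

lemma mem_cube {d : ℕ} {η : ℝ} (hη : 0 < η) {k : ℕ} {x : Fin d → ℤ} {z : Ed d} :
    z ∈ cube η k x ↔ idx η z ∈ blk k x := by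
  rw [cube, mem_cell_iff (by positivity), mem_blk]
  simp only [funext_iff, idx_mul_two_pow]

lemma cube_congr {d : ℕ} {η : ℝ} {k : ℕ} {x y : Fin d → ℤ} (h : y ∈ blk k x) :
    cube η k y = cube η k x := by
  rw [cube, cube, funext (mem_blk.1 h)]

lemma exists_idx_eq {d : ℕ} {η : ℝ} (hη : 0 < η) (y : Fin d → ℤ) : ∃ z : Ed d, idx η z = y := by
  refine ⟨WithLp.toLp 2 fun i => η * y i, ?_⟩
  ext i
  simp [idx, mul_div_cancel_left₀ _ hη.ne']

lemma cube_subset_iff {d : ℕ} {η : ℝ} (hη : 0 < η) {j k : ℕ} {x y : Fin d → ℤ} :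
    cube η k x ⊆ cube η j y ↔ blk k x ⊆ blk j y := by
  constructor
  · intro h p hp
    obtain ⟨z, rfl⟩ := exists_idx_eq hη p
    exact (mem_cube hη).1 (h ((mem_cube hη).2 hp))
  · intro h z hz
    exact (mem_cube hη).2 (h ((mem_cube hη).1 hz))

lemma le_of_blk_subset {d : ℕ} (hd : 1 ≤ d) {j k : ℕ} {x y : Fin d → ℤ}
    (h : blk k x ⊆ blk j y) : k ≤ j := by
  have := Finset.card_le_card h
  rw [card_blk, card_blk] at this
  exact (pow_le_pow_iff_right₀ (Nat.one_lt_two_pow (by omega))).1 this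

/-- The weighted sum over a family of subcubes of one cube is controlled by the edge differences
inside that cube. -/
lemma sum_subcubes_le {d : ℕ} (hd : 1 ≤ d) {F : Ed d → ℝ} (hF : Integrable F) {η : ℝ} (hη : 0 < η)
    {K : ℕ} {x₀ : Fin d → ℤ} (A : Finset (Set (Ed d))) (lam : Set (Ed d) → ℝ)
    (kk : Set (Ed d) → ℕ)
    (hA : ∀ Q ∈ A, ∃ x, Q = cube η (kk Q) x ∧ blk (kk Q) x ⊆ blk K x₀)
    (hle : ∀ Q ∈ A, lam Q ≤ ⨍ z in Q, F z)
    (hmax : ∀ k ≤ K, ∀ x ∈ blk K x₀, cube η k x ∈ A → ∀ j, k < j → j ≤ K →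
      ⨍ z in cube η j x, F z ≤ lam (cube η k x))
    (hdens : ∀ k ≤ K, ∀ x ∈ blk K x₀, cube η k x ∈ A →
      bavg (fun y => if lam (cube η k x) < cellAvg F η y then (1:ℝ) else 0) k x ≤ 1 / 2) :
    ∑ Q ∈ A, (η * 2 ^ kk Q) ^ (d - 1) * ((⨍ z in Q, F z) - lam Q) ≤
      6 / dens d * ∑ y ∈ blk K x₀, η ^ (d - 1) * edgeVar K (cellAvg F η) y := by
  classical
  obtain ⟨m, hm⟩ : ∃ m, ∀ Q ∈ A, m ≤ lam Q := by
    obtain ⟨m, hm⟩ := (A.image lam).bddBelow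
    exact ⟨m, fun Q hQ => hm (Finset.mem_coe.2 (Finset.mem_image_of_mem _ hQ))⟩
  let v : Set (Ed d) → ℝ := fun Q => (⨍ z in Q, F z) - lam Q
  have hv : ∀ Q ∈ A, 0 ≤ v Q := fun Q hQ => sub_nonneg.2 (hle Q hQ)
  let β : ℕ → (Fin d → ℤ) → ℝ := fun k x => ∑ Q ∈ A, if cube η k x = Q then v Q else 0
  have hβ : ∀ k ≤ K, ∀ x ∈ blk K x₀, β k x ≤ 0 ∨ ∃ l, runMax (cellAvg F η) m K k x ≤ l ∧
      bavg (fun y => if l < cellAvg F η y then (1:ℝ) else 0) k x ≤ 1 / 2 ∧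
      β k x ≤ bavg (cellAvg F η) k x - l := by
    intro k hk x hx
    by_cases hQ : cube η k x ∈ A
    · refine Or.inr ⟨lam (cube η k x), runMax_le (hm _ hQ) fun j hj hjK => ?_,
        hdens k hk x hx hQ, ?_⟩
      · rw [bavg_cellAvg hF hη]
        exact hmax k hk x hx hQ j hj hjK
      · rw [bavg_cellAvg hF hη]
        simp only [β, Finset.sum_ite_eq, if_pos hQ]
        exact le_rfl
    · left
      simp only [β, Finset.sum_ite_eq, if_neg hQ]
      exact le_rfl
  have hmain := lattice_bound (cellAvg F η) m K x₀ β hβ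
  have hsum : ∑ Q ∈ A, (2 ^ kk Q) ^ (d - 1) * v Q ≤
      ∑ k ∈ Finset.range (K + 1), ∑ x ∈ blk K x₀, β k x / 2 ^ k := by
    have hswap : ∑ k ∈ Finset.range (K + 1), ∑ x ∈ blk K x₀, β k x / 2 ^ k =
        ∑ Q ∈ A, ∑ k ∈ Finset.range (K + 1), ∑ x ∈ blk K x₀,
          (if cube η k x = Q then v Q else 0) / 2 ^ k := by
      simp only [β, Finset.sum_div]
      rw [Finset.sum_congr rfl fun k _ => Finset.sum_comm, Finset.sum_comm]
    rw [hswap]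
    refine Finset.sum_le_sum fun Q hQ => ?_
    obtain ⟨x, hQx, hsub⟩ := hA Q hQ
    have hnn : ∀ k y, 0 ≤ (if cube η k y = Q then v Q else 0) / 2 ^ k := by
      intro k y
      refine div_nonneg ?_ (by positivity)
      split_ifs
      exacts [hv Q hQ, le_rfl]
    calc (2 ^ kk Q) ^ (d - 1) * v Q = ∑ y ∈ blk (kk Q) x, v Q / 2 ^ kk Q := by
          rw [Finset.sum_const, card_blk, nsmul_eq_mul]
          obtain ⟨e, rfl⟩ := Nat.exists_eq_add_of_le' hd
          push_cast
          rw [← pow_mul, ← pow_mul, mul_comm (e + 1), mul_add, mul_one, pow_add]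
          field_simp
      _ = ∑ y ∈ blk (kk Q) x, (if cube η (kk Q) y = Q then v Q else 0) / 2 ^ kk Q := by
          refine Finset.sum_congr rfl fun y hy => ?_
          rw [if_pos ((cube_congr hy).trans hQx.symm)]
      _ ≤ ∑ y ∈ blk K x₀, (if cube η (kk Q) y = Q then v Q else 0) / 2 ^ kk Q :=
          Finset.sum_le_sum_of_subset_of_nonneg hsub fun y _ _ => hnn _ y
      _ ≤ _ := Finset.single_le_sum
          (f := fun k => ∑ y ∈ blk K x₀, (if cube η k y = Q then v Q else 0) / 2 ^ k)
          (fun k _ => Finset.sum_nonneg fun y _ => hnn k y)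
          (Finset.mem_range.2 (Nat.lt_succ_of_le (le_of_blk_subset hd hsub)))
  have hp : 0 ≤ η ^ (d - 1) := by positivity
  calc ∑ Q ∈ A, (η * 2 ^ kk Q) ^ (d - 1) * ((⨍ z in Q, F z) - lam Q)
      = η ^ (d - 1) * ∑ Q ∈ A, (2 ^ kk Q) ^ (d - 1) * v Q := by
        rw [Finset.mul_sum]
        refine Finset.sum_congr rfl fun Q _ => ?_
        rw [mul_pow, mul_assoc]
    _ ≤ η ^ (d - 1) * (6 / dens d * ∑ y ∈ blk K x₀, edgeVar K (cellAvg F η) y) :=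
        mul_le_mul_of_nonneg_left (hsum.trans hmain) hp
    _ = _ := by rw [← Finset.mul_sum]; ring


/-- Edge differences inside pairwise disjoint cubes are controlled by the variation. -/
lemma sum_edgeVar_le_var {d : ℕ} (hd : 1 ≤ d) {F : Ed d → ℝ} {η : ℝ} (hη : 0 < η)
    {ι : Type*} (R : Finset ι) (K : ι → ℕ) (x₀ : ι → Fin d → ℤ)
    (hdisj : ∀ r ∈ R, ∀ s ∈ R, r ≠ s → Disjoint (blk (K r) (x₀ r)) (blk (K s) (x₀ s)))
    {U : Set (Ed d)} (hFU : IntegrableOn F U) (hU : ∀ r ∈ R, interior (cube η (K r) (x₀ r)) ⊆ U) :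
    ENNReal.ofReal (∑ r ∈ R, ∑ y ∈ blk (K r) (x₀ r), η ^ (d - 1) * edgeVar (K r) (cellAvg F η) y) ≤
      2 * d * var U F := by
  classical
  let w : Fin d → (Fin d → ℤ) → ℝ := fun i y =>
    η⁻¹ * |(∫ x in cell η y, F x) - ∫ x in cell η (y + Pi.single i 1), F x|
  have hw : ∀ i y, 0 ≤ w i y := fun i y => by positivity
  have hterm : ∀ i y, η ^ (d - 1) * |cellAvg F η y - cellAvg F η (y + Pi.single i 1)| = w i y := by
    intro i y
    obtain ⟨e, rfl⟩ := Nat.exists_eq_add_of_le' hd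
    simp only [w, cellAvg_eq F hη]
    rw [← sub_div, abs_div, abs_of_pos (show 0 < η ^ (e + 1) by positivity), Nat.add_sub_cancel,
      pow_succ]
    field_simp
  let E : Fin d → Finset (Fin d → ℤ) := fun i =>
    R.biUnion fun r => (blk (K r) (x₀ r)).filter fun y => y + Pi.single i 1 ∈ blk (K r) y
  have hE : ∑ r ∈ R, ∑ y ∈ blk (K r) (x₀ r), η ^ (d - 1) * edgeVar (K r) (cellAvg F η) y =
      ∑ i, ∑ p ∈ E i, w i p := by
    have h1 : ∀ i, ∑ p ∈ E i, w i p = ∑ r ∈ R, ∑ y ∈ blk (K r) (x₀ r),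
        if y + Pi.single i 1 ∈ blk (K r) y then w i y else 0 := by
      intro i
      rw [Finset.sum_biUnion]
      · simp only [Finset.sum_filter]
      · intro r hr s hs hrs
        exact (hdisj r hr s hs hrs).mono (Finset.filter_subset _ _) (Finset.filter_subset _ _)
    simp only [h1]
    rw [Finset.sum_comm]
    refine Finset.sum_congr rfl fun r _ => ?_
    rw [Finset.sum_comm]
    refine Finset.sum_congr rfl fun y _ => ?_
    rw [edgeVar, Finset.mul_sum]
    refine Finset.sum_congr rfl fun i _ => ?_
    rw [mul_ite, mul_zero, hterm]
  have hbox : ∀ i, ∀ p ∈ E i, openBox η i p ⊆ U := by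
    intro i p hp
    obtain ⟨r, hr, hp⟩ := Finset.mem_biUnion.1 hp
    obtain ⟨hp1, hp2⟩ := Finset.mem_filter.1 hp
    refine Set.Subset.trans ?_ (hU r hr)
    refine Set.Subset.trans ?_ (openCell_subset_interior _ _)
    rw [mem_blk] at hp1 hp2
    have hpow : (0:ℤ) < 2 ^ K r := by positivity
    intro z hz j
    have hlo : 2 ^ K r * (x₀ r j / 2 ^ K r) ≤ p j := by
      rw [← hp1 j]; exact Int.mul_ediv_self_le hpow.ne'
    have hhi : ∀ q : ℤ, q / 2 ^ K r = x₀ r j / 2 ^ K r → q + 1 ≤ 2 ^ K r * (x₀ r j / 2 ^ K r + 1) := by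
      intro q hq
      rw [← hq]
      have := Int.lt_mul_ediv_self_add (x := q) hpow
      linarith
    have hlo' : (2:ℝ) ^ K r * ((x₀ r j / 2 ^ K r : ℤ) : ℝ) ≤ p j := by exact_mod_cast hlo
    by_cases hj : j = i
    · subst hj
      have h2 := hhi (p j + 1) (by rw [← hp1 j, ← hp2 j]; simp)
      have h2' : (p j : ℝ) + 1 + 1 ≤ (2:ℝ) ^ K r * (((x₀ r j / 2 ^ K r : ℤ) : ℝ) + 1) := by
        exact_mod_cast h2
      have := hz.1
      constructor
      · nlinarith [this.1]
      · nlinarith [this.2]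
    · have h2 := hhi (p j) (hp1 j)
      have h2' : (p j : ℝ) + 1 ≤ (2:ℝ) ^ K r * (((x₀ r j / 2 ^ K r : ℤ) : ℝ) + 1) := by
        exact_mod_cast h2
      have := hz.2 j hj
      constructor
      · nlinarith [this.1]
      · nlinarith [this.2]
  rw [hE, ENNReal.ofReal_sum_of_nonneg fun i _ => Finset.sum_nonneg fun p _ => hw i p]
  calc ∑ i, ENNReal.ofReal (∑ p ∈ E i, w i p) ≤ ∑ _i : Fin d, 2 * var U F := by
        refine Finset.sum_le_sum fun i _ => ?_
        rw [ENNReal.ofReal_sum_of_nonneg fun p _ => hw i p]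
        exact sum_edges_le_var hη hFU i (E i) (hbox i)
    _ = _ := by simp; ring

lemma isDyadicCube_iff {d : ℕ} {Q : Set (Ed d)} :
    IsDyadicCube Q ↔ ∃ (n : ℤ) (m : Fin d → ℤ), Q = cell ((2:ℝ) ^ n) m := Iff.rfl

/-- The lattice points `2 ^ k * m`. -/
def corner {d : ℕ} (k : ℕ) (m : Fin d → ℤ) : Fin d → ℤ := fun i => 2 ^ k * m i

lemma cube_corner {d : ℕ} (η : ℝ) (k : ℕ) (m : Fin d → ℤ) :
    cube η k (corner k m) = cell (η * 2 ^ k) m := by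
  rw [cube]
  congr 1
  ext i
  exact Int.mul_ediv_cancel_left _ (by positivity)

lemma isDyadicCube_cube {d : ℕ} (M k : ℕ) (x : Fin d → ℤ) :
    IsDyadicCube (cube ((1 / 2 : ℝ) ^ M) k x) := by
  refine ⟨(k : ℤ) - M, fun i => x i / 2 ^ k, ?_⟩
  rw [zpow_sub₀ (by norm_num), zpow_natCast, zpow_natCast, cube, one_div, inv_pow, div_eq_inv_mul]
  rfl

/-- The estimate for a finite family of cubes that are maximal at suitable levels and have low
density there. -/
lemma sum_active_le {d : ℕ} (hd : 1 ≤ d) {𝒬 : Finset (Set (Ed d))} (lev : Set (Ed d) → ℤ)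
    (ind : Set (Ed d) → Fin d → ℤ) (hQ : ∀ Q ∈ 𝒬, Q = cell ((2:ℝ) ^ lev Q) (ind Q))
    (hclosed : ∀ P : Set (Ed d), IsDyadicCube P → P ⊆ (⋃ Q ∈ 𝒬, Q) →
      (∃ Q ∈ 𝒬, Q ⊆ P) → P ∈ 𝒬)
    {F : Ed d → ℝ} (hF : Integrable F) {A : Finset (Set (Ed d))} (hA : A ⊆ 𝒬)
    (lam : Set (Ed d) → ℝ) (hle : ∀ Q ∈ A, lam Q ≤ ⨍ z in Q, F z)
    (hmax : ∀ Q ∈ A, ∀ P ∈ 𝒬, Q ⊆ P → P ≠ Q → ⨍ z in P, F z ≤ lam Q)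
    (hdens : ∀ Q ∈ A, ∃ l < lam Q, volume (Q ∩ {x | l < F x}) < volume Q / 2 ^ (d + 2)) :
    ENNReal.ofReal (∑ Q ∈ A, ((2:ℝ) ^ lev Q) ^ (d - 1) * ((⨍ z in Q, F z) - lam Q)) ≤
      ENNReal.ofReal (6 / dens d) * (2 * d) * var (⋃ Q ∈ 𝒬, interior Q) F := by
  classical
  have hη : Tendsto (fun M : ℕ => (1 / 2 : ℝ) ^ M) atTop (𝓝[>] 0) :=
    tendsto_nhdsWithin_iff.2 ⟨tendsto_pow_atTop_nhds_zero_of_lt_one (by norm_num) (by norm_num),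
      Eventually.of_forall fun M => by simp⟩
  have hev1 : ∀ᶠ M : ℕ in atTop, ∀ Q ∈ 𝒬, 0 ≤ lev Q + M := by
    rw [Filter.eventually_all_finset]
    intro Q _
    filter_upwards [eventually_ge_atTop (lev Q).natAbs] with M hM
    omega
  have hev2 : ∀ᶠ M : ℕ in atTop, ∀ Q ∈ A, ∀ k : ℕ, (2:ℝ) ^ lev Q = (1 / 2 : ℝ) ^ M * 2 ^ k →
      ∀ x : Fin d → ℤ, (fun i => x i / 2 ^ k) = ind Q →
      bavg (fun y => if lam Q < cellAvg F ((1 / 2 : ℝ) ^ M) y then (1:ℝ) else 0) k x ≤ 1 / 2 := by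
    rw [Filter.eventually_all_finset]
    intro Q hQA
    obtain ⟨l, hl, hvol⟩ := hdens Q hQA
    refine eventually_bavg_le hd hF hη (by positivity) (ind Q) hl ?_
    rwa [← hQ Q (hA hQA)]
  obtain ⟨M, hM1, hM2⟩ := (hev1.and hev2).exists
  set η : ℝ := (1 / 2 : ℝ) ^ M with hηdef
  have hη0 : 0 < η := by positivity
  let kk : Set (Ed d) → ℕ := fun Q => (lev Q + M).toNat
  let xx : Set (Ed d) → Fin d → ℤ := fun Q => corner (kk Q) (ind Q)
  have hside : ∀ Q ∈ 𝒬, (2:ℝ) ^ lev Q = η * 2 ^ kk Q := by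
    intro Q hQ'
    have : ((kk Q : ℕ) : ℤ) = lev Q + M := Int.toNat_of_nonneg (hM1 Q hQ')
    rw [← zpow_natCast (2:ℝ) (kk Q), this, zpow_add₀ (by norm_num), hηdef, zpow_natCast, one_div,
      inv_pow]
    field_simp
  have hcube : ∀ Q ∈ 𝒬, Q = cube η (kk Q) (xx Q) := by
    intro Q hQ'
    rw [cube_corner, ← hside Q hQ']
    exact hQ Q hQ'
  have hroot : ∀ Q ∈ 𝒬, ∃ R ∈ 𝒬, Q ⊆ R ∧ ∀ P ∈ 𝒬, R ⊆ P → P = R := by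
    intro Q hQ'
    obtain ⟨R, hR, hmR⟩ := 𝒬.exists_le_maximal hQ'
    exact ⟨R, hmR.prop, hR, fun P hP h => Set.Subset.antisymm (hmR.le_of_ge hP h) h⟩
  choose! root hroot1 hroot2 hroot3 using hroot
  let Rs := A.image root
  have hRs : ∀ R ∈ Rs, R ∈ 𝒬 ∧ ∀ P ∈ 𝒬, R ⊆ P → P = R := by
    intro R hR
    obtain ⟨Q, hQA, rfl⟩ := Finset.mem_image.1 hR
    exact ⟨hroot1 Q (hA hQA), hroot3 Q (hA hQA)⟩
  have hdisj : ∀ r ∈ Rs, ∀ s ∈ Rs, r ≠ s →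
      Disjoint (blk (kk r) (xx r)) (blk (kk s) (xx s)) := by
    intro r hr s hs hrs
    by_contra hnd
    obtain ⟨y, hy1, hy2⟩ := Finset.not_disjoint_iff.1 hnd
    wlog hle' : kk r ≤ kk s generalizing r s
    · exact this s hs r hr hrs.symm (fun h => hnd h.symm) hy2 hy1 (by omega)
    have hsub : r ⊆ s := by
      rw [hcube r (hRs r hr).1, hcube s (hRs s hs).1, cube_subset_iff hη0, ← blk_eq hy1, ← blk_eq hy2]
      exact blk_mono hle' y
    exact hrs ((hRs r hr).2 s (hRs s hs).1 hsub).symm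
  have hreal : ∑ Q ∈ A, ((2:ℝ) ^ lev Q) ^ (d - 1) * ((⨍ z in Q, F z) - lam Q) ≤
      6 / dens d * ∑ r ∈ Rs, ∑ y ∈ blk (kk r) (xx r),
        η ^ (d - 1) * edgeVar (kk r) (cellAvg F η) y := by
    rw [← Finset.sum_fiberwise_of_maps_to (t := Rs) (g := root)
      fun Q hQA => Finset.mem_image_of_mem _ hQA, Finset.mul_sum]
    refine Finset.sum_le_sum fun r hr => ?_
    have hsubA : ∀ {Q}, Q ∈ A.filter (fun Q => root Q = r) → Q ∈ A := fun h =>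
      (Finset.mem_filter.1 h).1
    rw [Finset.sum_congr rfl fun Q hQ' => by rw [hside Q (hA (hsubA hQ'))]]
    refine sum_subcubes_le hd hF hη0 _ lam kk (fun Q hQ' => ⟨xx Q, hcube Q (hA (hsubA hQ')), ?_⟩)
      (fun Q hQ' => hle Q (hsubA hQ')) (fun k hk x hx hxA j hkj hjK => ?_)
      fun k hk x hx hxA => ?_
    · have := hroot2 Q (hA (hsubA hQ'))
      rw [(Finset.mem_filter.1 hQ').2] at this
      rw [← cube_subset_iff hη0, ← hcube Q (hA (hsubA hQ')), ← hcube r (hRs r hr).1]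
      exact this
    · have hsub : cube η k x ⊆ cube η j x := (cube_subset_iff hη0).2 (blk_mono hkj.le x)
      refine hmax _ (hsubA hxA) _ (hclosed _ (isDyadicCube_cube M j x) ?_
        ⟨_, hA (hsubA hxA), hsub⟩) hsub fun h => ?_
      · refine Set.Subset.trans ?_ (Set.subset_biUnion_of_mem (u := id) (hRs r hr).1)
        rw [id, hcube r (hRs r hr).1, cube_subset_iff hη0]
        exact blk_subset_blk hjK hx
      · exact absurd (le_of_blk_subset hd ((cube_subset_iff hη0).1 h.subset)) (by omega)
    · have hQ' := hA (hsubA hxA)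
      have hk' : kk (cube η k x) = k := by
        have h := hcube _ hQ'
        exact le_antisymm (le_of_blk_subset hd ((cube_subset_iff hη0).1 h.symm.subset))
          (le_of_blk_subset hd ((cube_subset_iff hη0).1 h.subset))
      refine hM2 _ (hsubA hxA) k ?_ x ?_
      · rw [hside _ hQ', hk']
      · have h := (cube_subset_iff hη0).1 (hcube _ hQ').subset (mem_blk_self k x)
        rw [hk', mem_blk] at h
        ext i
        rw [h i]
        simp only [xx, hk', corner]
        exact Int.mul_ediv_cancel_left _ (by positivity)
  refine (ENNReal.ofReal_le_ofReal hreal).trans ?_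
  rw [ENNReal.ofReal_mul (by have := dens_pos d; positivity), mul_assoc]
  gcongr
  refine sum_edgeVar_le_var hd hη0 Rs kk xx hdisj hF.integrableOn fun r hr => ?_
  rw [← hcube r (hRs r hr).1]
  exact Set.subset_biUnion_of_mem (u := fun Q => interior Q) (hRs r hr).1

lemma exists_seq_volume_le {S : Set ℝ} {b : ℝ} (hS : ∀ s ∈ S, s < b) (hne : S.Nonempty) :
    ∃ (t : ℕ → ℝ) (L : ℝ≥0∞), (∀ n, t n ≤ b ∧ ∃ s ∈ S, s < t n) ∧ volume S ≤ L ∧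
      Tendsto (fun n => ENNReal.ofReal (b - t n)) atTop (𝓝 L) := by
  let T : Set ℝ≥0∞ := (fun t => ENNReal.ofReal (b - t)) '' {t | t ≤ b ∧ ∃ s ∈ S, s < t}
  have hT : T.Nonempty := by
    obtain ⟨s, hs⟩ := hne
    exact ⟨_, b, ⟨le_rfl, s, hs, hS s hs⟩, rfl⟩
  obtain ⟨u, -, hu, huT⟩ := exists_seq_tendsto_sSup hT (OrderTop.bddAbove T)
  choose t ht htu using huT
  refine ⟨t, sSup T, ht, ?_, by simpa only [htu] using hu⟩
  by_cases hL : sSup T = ∞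
  · simp [hL]
  have hsub : S ⊆ Set.Ico (b - (sSup T).toReal) b := by
    refine fun s hs => ⟨?_, hS s hs⟩
    by_contra! h
    obtain ⟨r, hr1, hr2⟩ := exists_between h
    have h0 : 0 ≤ (sSup T).toReal := ENNReal.toReal_nonneg
    have hmem : ENNReal.ofReal (b - r) ∈ T := ⟨r, ⟨by linarith, s, hs, hr1⟩, rfl⟩
    have := ENNReal.toReal_mono hL (le_sSup hmem)
    rw [ENNReal.toReal_ofReal (by linarith)] at this
    linarith
  calc volume S ≤ volume (Set.Ico (b - (sSup T).toReal) b) := measure_mono hsub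
    _ = sSup T := by rw [Real.volume_Ico, sub_sub_cancel, ENNReal.ofReal_toReal hL]

lemma low_density_bound_of_integrable (d : ℕ) (hd : 1 ≤ d) :
    ∃ C : ℝ≥0∞, C ≠ ∞ ∧
      ∀ (𝒬 : Finset (Set (Ed d))), (∀ Q ∈ 𝒬, IsDyadicCube Q) →
        (∀ P : Set (Ed d), IsDyadicCube P → P ⊆ (⋃ Q ∈ 𝒬, Q) →
          (∃ Q ∈ 𝒬, Q ⊆ P) → P ∈ 𝒬) →
        ∀ F : Ed d → ℝ, Integrable F →
          ∑ Q ∈ 𝒬, ∫⁻ lam in {lam : ℝ | IsMaximalCube 𝒬 F lam Q ∧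
              volume (Q ∩ {x | lam < F x}) < volume Q / 2 ^ (d + 2)},
            μH[(d:ℝ) - 1] (frontier Q) ≤
          C * var (⋃ Q ∈ 𝒬, interior Q) F := by
  classical
  obtain ⟨C, hC, hfr⟩ := exists_hausdorffMeasure_frontier_le d hd
  refine ⟨C * (ENNReal.ofReal (6 / dens d) * (2 * d)), ENNReal.mul_ne_top hC
    (ENNReal.mul_ne_top ENNReal.ofReal_ne_top (ENNReal.mul_ne_top (by simp) (by simp))), ?_⟩
  intro 𝒬 h𝒬 hclosed F hF
  choose! lev ind hQ using h𝒬
  have hQ : ∀ Q ∈ 𝒬, Q = cell ((2:ℝ) ^ lev Q) (ind Q) := hQ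
  let S : Set (Ed d) → Set ℝ := fun Q => {lam : ℝ | IsMaximalCube 𝒬 F lam Q ∧
    volume (Q ∩ {x | lam < F x}) < volume Q / 2 ^ (d + 2)}
  let A := 𝒬.filter fun Q => (S Q).Nonempty
  have hA : A ⊆ 𝒬 := Finset.filter_subset _ _
  have hseq : ∀ Q ∈ A, ∃ (t : ℕ → ℝ) (L : ℝ≥0∞),
      (∀ n, t n ≤ ⨍ z in Q, F z ∧ ∃ s ∈ S Q, s < t n) ∧ volume (S Q) ≤ L ∧
      Tendsto (fun n => ENNReal.ofReal ((⨍ z in Q, F z) - t n)) atTop (𝓝 L) := fun Q hQA =>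
    exists_seq_volume_le (fun s hs => hs.1.2.1) (Finset.mem_filter.1 hQA).2
  choose! t L ht hvol htend using hseq
  have hw : ∀ Q, 0 ≤ ((2:ℝ) ^ lev Q) ^ (d - 1) := fun Q => by positivity
  have hbound : ∑ Q ∈ A, ENNReal.ofReal (((2:ℝ) ^ lev Q) ^ (d - 1)) * L Q ≤
      ENNReal.ofReal (6 / dens d) * (2 * d) * var (⋃ Q ∈ 𝒬, interior Q) F := by
    refine le_of_tendsto' (tendsto_finsetSum A fun Q hQA =>
      ENNReal.Tendsto.const_mul (htend Q hQA) (Or.inr ENNReal.ofReal_ne_top)) fun n => ?_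
    have h := sum_active_le hd lev ind hQ hclosed hF hA (fun Q => t Q n)
      (fun Q hQA => (ht Q hQA n).1) (fun Q hQA P hP hQP hne => ?_) fun Q hQA => ?_
    · rw [ENNReal.ofReal_sum_of_nonneg fun Q hQA =>
        mul_nonneg (hw Q) (sub_nonneg.2 (ht Q hQA n).1)] at h
      simpa only [ENNReal.ofReal_mul (hw _)] using h
    · obtain ⟨-, s, hs, hst⟩ := ht Q hQA n
      by_contra! hlt
      exact hne (hs.1.2.2 P hP (hst.trans hlt) hQP)
    · obtain ⟨-, s, hs, hst⟩ := ht Q hQA n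
      exact ⟨s, hst, hs.2⟩
  calc ∑ Q ∈ 𝒬, ∫⁻ lam in S Q, μH[(d:ℝ) - 1] (frontier Q)
      = ∑ Q ∈ A, μH[(d:ℝ) - 1] (frontier Q) * volume (S Q) := by
        simp only [setLIntegral_const]
        refine (Finset.sum_filter_of_ne fun Q _ hne => ?_).symm
        by_contra h
        rw [Set.not_nonempty_iff_eq_empty.1 h] at hne
        simp at hne
    _ ≤ ∑ Q ∈ A, C * (ENNReal.ofReal (((2:ℝ) ^ lev Q) ^ (d - 1)) * L Q) := by
        refine Finset.sum_le_sum fun Q hQA => ?_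
        rw [← mul_assoc]
        refine mul_le_mul' ?_ (hvol Q hQA)
        have := hfr ((2:ℝ) ^ lev Q) (by positivity) (ind Q)
        rwa [← hQ Q (hA hQA)] at this
    _ ≤ _ := by
        rw [← Finset.mul_sum, mul_assoc]
        gcongr

lemma var_congr {d : ℕ} {U : Set (Ed d)} (hU : MeasurableSet U) {f g : Ed d → ℝ}
    (h : Set.EqOn f g U) : var U f = var U g := by
  simp only [var]
  refine iSup_congr fun φ => iSup_congr fun _ => congrArg ENNReal.ofReal (setIntegral_congr_fun hU fun x hx => ?_)
  simp only [h hx]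

/-- The low-density part of the variation of the finite dyadic maximal function is bounded:
`Σ_{Q ∈ 𝒬} ∫_{λ : Q ∈ 𝒬_λ, |Q ∩ {f > λ}| < 2^{-d-2}|Q|} σ(∂Q) dλ ≤ C_d · var_{⋃ int Q} f`. -/
theorem low_density_cubes_bound (d : ℕ) (hd : 1 ≤ d) :
    ∃ C : ℝ≥0∞, C ≠ ∞ ∧
      ∀ (𝒬 : Finset (Set (Ed d))), (∀ Q ∈ 𝒬, IsDyadicCube Q) →
        (∀ P : Set (Ed d), IsDyadicCube P → P ⊆ (⋃ Q ∈ 𝒬, Q) →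
          (∃ Q ∈ 𝒬, Q ⊆ P) → P ∈ 𝒬) →
        ∀ (Ω : Set (Ed d)), IsOpen Ω → (⋃ Q ∈ 𝒬, interior Q) ⊆ Ω →
          ∀ f : Ed d → ℝ, IntegrableOn f Ω volume →
            ∑ Q ∈ 𝒬, ∫⁻ lam in {lam : ℝ | IsMaximalCube 𝒬 f lam Q ∧
                volume (Q ∩ {x | lam < f x}) < volume Q / 2 ^ (d + 2)},
              μH[(d:ℝ) - 1] (frontier Q) ≤
            C * var (⋃ Q ∈ 𝒬, interior Q) f := by
  obtain ⟨C, hC, hbound⟩ := low_density_bound_of_integrable d hd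
  refine ⟨C, hC, fun 𝒬 h𝒬 hclosed Ω _ hUΩ f hf => ?_⟩
  have hmeas : ∀ Q ∈ 𝒬, MeasurableSet Q := by
    intro Q hQ
    obtain ⟨n, m, h⟩ := isDyadicCube_iff.1 (h𝒬 Q hQ)
    exact h ▸ measurableSet_cell _ _
  have hint : ∀ Q ∈ 𝒬, IntegrableOn f Q := by
    intro Q hQ
    obtain ⟨n, m, h⟩ := isDyadicCube_iff.1 (h𝒬 Q hQ)
    have h1 : openCell ((2:ℝ) ^ n) m ⊆ Ω := by
      refine (openCell_subset_interior _ _).trans ?_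
      rw [← h]
      exact (Set.subset_biUnion_of_mem (u := fun Q => interior Q) hQ).trans hUΩ
    rw [h]
    exact (hf.mono_set h1).congr_set_ae (openCell_ae_eq_cell _ _).symm
  set V : Set (Ed d) := ⋃ Q ∈ 𝒬, Q
  have hV : MeasurableSet V := 𝒬.measurableSet_biUnion hmeas
  set F : Ed d → ℝ := V.indicator f with hFdef
  have hF : Integrable F := (integrable_indicator_iff hV).2
    (integrableOn_finset_iUnion.2 hint)
  have heq : ∀ Q ∈ 𝒬, Set.EqOn F f Q := fun Q hQ x hx =>
    Set.indicator_of_mem (Set.mem_biUnion hQ hx) f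
  have havg : ∀ Q ∈ 𝒬, ⨍ z in Q, F z = ⨍ z in Q, f z := by
    intro Q hQ
    rw [setAverage_eq, setAverage_eq, setIntegral_congr_fun (hmeas Q hQ) (heq Q hQ)]
  have hvar : var (⋃ Q ∈ 𝒬, interior Q) F = var (⋃ Q ∈ 𝒬, interior Q) f := by
    refine var_congr (𝒬.measurableSet_biUnion fun Q _ => isOpen_interior.measurableSet) ?_
    intro x hx
    obtain ⟨Q, hQ, hxQ⟩ := Set.mem_iUnion₂.1 hx
    exact heq Q hQ (interior_subset hxQ)
  rw [← hvar]
  refine le_trans (le_of_eq (Finset.sum_congr rfl fun Q hQ => ?_)) (hbound 𝒬 h𝒬 hclosed F hF)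
  congr 3
  ext lam
  refine and_congr ?_ ?_
  · refine and_congr Iff.rfl (and_congr ?_ (forall₂_congr fun P hP => ?_))
    · rw [havg Q hQ]
    · rw [havg P hP]
  · have : Q ∩ {x | lam < f x} = Q ∩ {x | lam < F x} := by
      ext x
      refine and_congr_right fun hx => ?_
      change lam < f x ↔ lam < F x
      rw [heq Q hQ hx]
    rw [this]

end
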